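/- arXiv:1706.08326 — 3 statements merged into one kernel-verified Lean document; each statement's English description precedes it below -/
import Mathlib

section
/- Let M be a von Neumann algebra and let T : M → M be a linear map which is either a derivation at zero or a triple derivation at zero. Then T is continuous. -/
/-- The C*-triple product `{a,b,c} = (1/2)(a b* c + c b* a)`. -/
noncomputable def trip {R : Type*} [NonUnitalRing R] [Module ℂ R] [Star R] (a b c : R) : R :=
  (2 : ℂ)⁻¹ • (a * star b * c + c * star b * a)

section Operators

variable {H : Type*} [NormedAddCommGroup H] [InnerProductSpace ℂ H] [CompleteSpace H]

/-- The spectral projection of a self-adjoint operator for the positive half-line. -/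
theorem IsSelfAdjoint.exists_isStarProjection_split {a : H →L[ℂ] H} (ha : IsSelfAdjoint a) :
    ∃ p : H →L[ℂ] H, IsStarProjection p ∧ (∀ y, Commute y a → Commute y p) ∧
      0 ≤ p * a ∧ (1 - p) * a ≤ 0 := by
  set b : H →L[ℂ] H := a⁺ with hb
  set c : H →L[ℂ] H := a⁻ with hc
  have hb0 : 0 ≤ b := CFC.posPart_nonneg a
  have hc0 : 0 ≤ c := CFC.negPart_nonneg a
  have hab : b - c = a := CFC.posPart_sub_negPart a
  have hbc : b * c = 0 := CFC.posPart_mul_negPart a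
  set K : Submodule ℂ H := b.range.topologicalClosure with hK
  have : CompleteSpace K := (Submodule.isClosed_topologicalClosure _).completeSpace_coe
  have hmem : ∀ x, b x ∈ K := fun x => Submodule.le_topologicalClosure _ ⟨x, rfl⟩
  have hpK : ∀ x, K.starProjection (b x) = b x := fun x =>
    Submodule.starProjection_eq_self_iff.2 (hmem x)
  have hpb : K.starProjection * b = b := by
    ext x; exact hpK x
  have hp : IsStarProjection K.starProjection := isStarProjection_starProjection
  have hpc : K.starProjection * c = 0 := by
    ext x
    refine (Submodule.starProjection_apply_eq_zero_iff K).2 ?_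
    rw [hK, Submodule.orthogonal_closure, Submodule.mem_orthogonal]
    rintro _ ⟨y, rfl⟩
    have h1 : inner ℂ (b y) (c x) = inner ℂ y ((b * c) x) := by
      have := hb0.isSelfAdjoint
      rw [ContinuousLinearMap.isSelfAdjoint_iff_isSymmetric] at this
      exact this y (c x)
    simpa [hbc] using h1
  have key : ∀ y, Commute y a → K.starProjection * y * K.starProjection = y * K.starProjection := by
    intro y hy
    have hyb : Commute y b := (hy.symm.cfcₙ_real _).symm
    have hinv : ∀ x ∈ K, y x ∈ K := by
      intro x hx
      refine map_mem_closure y.continuous hx ?_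
      rintro _ ⟨z, rfl⟩
      refine ⟨y z, ?_⟩
      exact congr($(hyb.symm.eq) z)
    ext x
    exact Submodule.starProjection_eq_self_iff.2 (hinv _ (Submodule.starProjection_apply_mem _ _))
  refine ⟨K.starProjection, hp, fun y hy => ?_, ?_, ?_⟩
  · have h1 := key y hy
    have hy' : Commute (star y) a := by
      have := hy.star_star
      rwa [ha.star_eq] at this
    have h2 := congr(star $(key _ hy'))
    simp only [star_mul, star_star, hp.isSelfAdjoint.star_eq, ← mul_assoc] at h2
    exact h1.symm.trans h2
  · rw [← hab, mul_sub, hpb, hpc, sub_zero]; exact hb0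
  · rw [← hab, mul_sub, sub_mul, sub_mul, hpb, hpc]
    simpa using hc0

theorem IsStarProjection.conj_nonneg {p a : H →L[ℂ] H} (hp : IsStarProjection p) (ha : 0 ≤ a) :
    0 ≤ p * a * p := by
  simpa [hp.isSelfAdjoint.star_eq] using star_left_conjugate_nonneg ha p

namespace VonNeumannAlgebra

variable (M : VonNeumannAlgebra H)

theorem mem_of_forall_commute {a p : H →L[ℂ] H} (ha : a ∈ M)
    (hp : ∀ y, Commute y a → Commute y p) : p ∈ M := by
  rw [← M.commutant_commutant, mem_commutant_iff]
  intro y hy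
  exact hp y ((mem_commutant_iff.1 hy a ha).symm)

theorem isClosed_toStarSubalgebra :
    IsClosed (M.toStarSubalgebra : Set (H →L[ℂ] H)) := by
  rw [coe_toStarSubalgebra, ← M.centralizer_centralizer]
  exact Set.isClosed_centralizer _

theorem complex_smul_mem (c : ℂ) {a : H →L[ℂ] H} (ha : a ∈ M) : c • a ∈ M :=
  M.toStarSubalgebra.smul_mem ha c

/-- Dyadic step in the spectral approximation of a positive contraction by projections. -/
theorem exists_isStarProjection_half {a : H →L[ℂ] H} (ha : a ∈ M) (h0 : 0 ≤ a) (h1 : a ≤ 1) :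
    ∃ p ∈ M, IsStarProjection p ∧ 0 ≤ (2 : ℂ) • a - p ∧ (2 : ℂ) • a - p ≤ 1 := by
  have hself : IsSelfAdjoint ((2 : ℂ) • a - 1) := by
    have := h0.isSelfAdjoint
    refine IsSelfAdjoint.sub (IsSelfAdjoint.smul ?_ this) (.one _)
    simp [IsSelfAdjoint]
  obtain ⟨p, hp, hcomm, hpos, hneg⟩ := hself.exists_isStarProjection_split
  have hm : (2 : ℂ) • a - 1 ∈ M := sub_mem (M.complex_smul_mem 2 ha) (one_mem M)
  refine ⟨p, M.mem_of_forall_commute hm hcomm, hp, ?_, ?_⟩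
  · have h2 := hp.one_sub.conj_nonneg h0
    have hap : Commute a p := hcomm a (by
      simp [Commute, SemiconjBy, mul_sub, sub_mul])
    have e : (2 : ℂ) • a - p = p * ((2 : ℂ) • a - 1) +
        ((1 - p) * a * (1 - p) + (1 - p) * a * (1 - p)) := by
      have hpa : ∀ x, p * (p * x) = p * x := fun x => by
        rw [← mul_assoc, hp.isIdempotentElem.eq]
      simp only [two_smul, mul_sub, sub_mul, mul_add, mul_one, one_mul, mul_assoc, hap.eq,
        hpa]
      abel
    rw [e]; positivity
  · have h2 := hp.conj_nonneg (sub_nonneg.2 h1)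
    have hap : Commute a p := hcomm a (by
      simp [Commute, SemiconjBy, mul_sub, sub_mul])
    rw [← sub_nonneg]
    have e : 1 - ((2 : ℂ) • a - p) = (p * (1 - a) * p + p * (1 - a) * p) +
        -((1 - p) * ((2 : ℂ) • a - 1)) := by
      have hpa : ∀ x, p * (p * x) = p * x := fun x => by
        rw [← mul_assoc, hp.isIdempotentElem.eq]
      simp only [two_smul, mul_sub, sub_mul, mul_add, mul_one, one_mul, mul_assoc, hap.eq,
        hpa, hp.isIdempotentElem.eq]
      abel
    rw [e]
    have := neg_nonneg.2 hneg
    positivity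

theorem norm_commutator_le {e : H →L[ℂ] H} (he : ∀ p ∈ M, IsStarProjection p → Commute e p)
    (n : ℕ) {a : H →L[ℂ] H} (ha : a ∈ M) (h0 : 0 ≤ a) (h1 : a ≤ 1) :
    ‖e * a - a * e‖ ≤ (1 / 2) ^ n * (2 * ‖e‖) := by
  induction n generalizing a with
  | zero =>
    have : ‖a‖ ≤ 1 := (CStarAlgebra.norm_le_one_iff_of_nonneg a).2 h1
    calc ‖e * a - a * e‖ ≤ ‖e‖ * ‖a‖ + ‖a‖ * ‖e‖ :=
          (norm_sub_le _ _).trans (add_le_add (norm_mul_le _ _) (norm_mul_le _ _))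
      _ ≤ _ := by nlinarith [norm_nonneg e]
  | succ n ih =>
    obtain ⟨p, hpM, hp, h2, h3⟩ := M.exists_isStarProjection_half ha h0 h1
    have := ih (sub_mem (M.complex_smul_mem 2 ha) hpM) h2 h3
    have e1 : e * ((2 : ℂ) • a - p) - ((2 : ℂ) • a - p) * e = (2 : ℂ) • (e * a - a * e) := by
      simp only [two_smul, mul_sub, sub_mul, mul_add, add_mul, (he p hpM hp).eq]
      abel
    rw [e1, norm_smul] at this
    norm_num at this
    rw [pow_succ]
    norm_num
    linarith

/-- An operator commuting with all projections of a von Neumann algebra commutes with it. -/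
theorem commute_of_forall_isStarProjection {e : H →L[ℂ] H}
    (he : ∀ p ∈ M, IsStarProjection p → Commute e p) {a : H →L[ℂ] H} (ha : a ∈ M) :
    Commute e a := by
  have unit : ∀ a ∈ M, 0 ≤ a → a ≤ 1 → Commute e a := by
    intro a ha h0 h1
    have h : Filter.Tendsto (fun n : ℕ => (1 / 2 : ℝ) ^ n * (2 * ‖e‖)) .atTop
        (nhds (0 * (2 * ‖e‖))) :=
      (tendsto_pow_atTop_nhds_zero_of_lt_one (by norm_num) (by norm_num)).mul_const _
    have := ge_of_tendsto' h fun n => M.norm_commutator_le he n ha h0 h1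
    rw [zero_mul, norm_le_zero_iff, sub_eq_zero] at this
    exact this
  have self : ∀ a ∈ M, IsSelfAdjoint a → Commute e a := by
    intro a ha hs
    set t : ℝ := ‖a‖ + 1 with ht
    have htpos : 0 < t := by positivity
    have hle : a ≤ algebraMap ℝ (H →L[ℂ] H) t :=
      hs.le_algebraMap_norm_self.trans (algebraMap_mono _ (by linarith))
    have hge : -algebraMap ℝ (H →L[ℂ] H) t ≤ a :=
      (neg_le_neg (algebraMap_mono _ (by linarith))).trans hs.neg_algebraMap_norm_le_self
    have hu := unit (((2 * t)⁻¹ : ℝ) • (a + algebraMap ℝ (H →L[ℂ] H) t))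
      (M.complex_smul_mem ((2 * t)⁻¹ : ℝ) (add_mem ha (algebraMap_mem M.toStarSubalgebra (t : ℂ))))
      (smul_nonneg (by positivity) (by rwa [← neg_le_iff_add_nonneg])) ?_
    · have h3 : Commute e (a + algebraMap ℝ (H →L[ℂ] H) t) := by
        have := hu.smul_right (2 * t)
        rwa [smul_smul, mul_inv_cancel₀ (by positivity), one_smul] at this
      have h4 := h3.sub_right (Algebra.commutes t e).symm
      rwa [add_sub_cancel_right] at h4
    · calc ((2 * t)⁻¹ : ℝ) • (a + algebraMap ℝ (H →L[ℂ] H) t)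
          ≤ ((2 * t)⁻¹ : ℝ) • (algebraMap ℝ (H →L[ℂ] H) t + algebraMap ℝ (H →L[ℂ] H) t) :=
            smul_le_smul_of_nonneg_left (add_le_add_left hle _) (by positivity)
        _ = 1 := by
          rw [Algebra.algebraMap_eq_smul_one, ← add_smul, smul_smul, ← two_mul,
            inv_mul_cancel₀ (by positivity), one_smul]
  have h1 := self (a + star a) (add_mem ha (star_mem ha)) (.add_star_self a)
  have h2 := self (Complex.I • (a - star a)) (M.complex_smul_mem _ (sub_mem ha (star_mem ha))) (by
    simp [IsSelfAdjoint, ← smul_neg])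
  have e : a = (2 : ℂ)⁻¹ • (a + star a) + (-(2 : ℂ)⁻¹ * Complex.I) • Complex.I • (a - star a) := by
    rw [smul_smul, mul_assoc, Complex.I_mul_I]
    module
  rw [e]
  exact (h1.smul_right _).add_right (h2.smul_right _)

end VonNeumannAlgebra

end Operators

namespace VonNeumannAlgebra

variable {H : Type*} [NormedAddCommGroup H] [InnerProductSpace ℂ H] [CompleteSpace H]
variable (M : VonNeumannAlgebra H)

/-- A projection of `M` dominating no projection of `M` other than `0` and itself. -/
structure IsMinimalProjection (f : H →L[ℂ] H) : Prop where
  mem : f ∈ M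
  isStarProjection : IsStarProjection f
  eq_zero_or_eq : ∀ p ∈ M, IsStarProjection p → f * p = p → p = 0 ∨ p = f

variable {M}

theorem IsMinimalProjection.nonneg_or_nonpos {f a : H →L[ℂ] H} (hf : M.IsMinimalProjection f)
    (ha : a ∈ M) (hs : IsSelfAdjoint a) (hfa : f * a = a) : 0 ≤ a ∨ a ≤ 0 := by
  obtain ⟨p, hp, hcomm, hpos, hneg⟩ := hs.exists_isStarProjection_split
  have haf : a * f = a := by
    simpa [hs.star_eq, hf.isStarProjection.isSelfAdjoint.star_eq] using congr(star $hfa)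
  have hc : Commute f p := hcomm f (hfa.trans haf.symm)
  have hpa : p * a = (f * p) * a := by rw [hc.eq, mul_assoc, hfa]
  rcases hf.eq_zero_or_eq (f * p) (mul_mem hf.mem (M.mem_of_forall_commute ha hcomm))
    (hf.isStarProjection.mul hp hc)
    (by rw [← mul_assoc, hf.isStarProjection.isIdempotentElem.eq]) with h | h
  · rw [h, zero_mul] at hpa
    right
    simpa [sub_mul, hpa] using hneg
  · rw [h, hfa] at hpa
    left
    rwa [← hpa]

theorem IsMinimalProjection.eq_norm_smul {f a : H →L[ℂ] H} (hf : M.IsMinimalProjection f)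
    (ha : a ∈ M) (h0 : 0 ≤ a) (hfa : f * a = a) : a = ‖a‖ • f := by
  have hs : IsSelfAdjoint a := h0.isSelfAdjoint
  have hfs := hf.isStarProjection.isSelfAdjoint
  have hff := hf.isStarProjection.isIdempotentElem.eq
  have haf : a * f = a := by
    simpa [hs.star_eq, hfs.star_eq] using congr(star $hfa)
  have hf0 : 0 ≤ f := by simpa [hff] using hf.isStarProjection.conj_nonneg zero_le_one
  refine le_antisymm ?_ ?_
  · have h1 := hf.isStarProjection.conj_nonneg (sub_nonneg.2 hs.le_algebraMap_norm_self)
    rw [Algebra.algebraMap_eq_smul_one] at h1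
    simpa [mul_sub, sub_mul, hfa, haf, hff] using h1
  · have key : ∀ t : ℝ, 0 ≤ t → t < ‖a‖ → t • f ≤ a := by
      intro t ht0 ht
      have hm : a - t • f ∈ M := sub_mem ha (M.complex_smul_mem (t : ℂ) hf.mem)
      rcases hf.nonneg_or_nonpos hm (hs.sub (.smul (.all t) hfs))
        (by rw [mul_sub, hfa, mul_smul_comm, hff]) with h | h
      · exact sub_nonneg.1 h
      · exfalso
        have h2 := CStarAlgebra.norm_le_norm_of_nonneg_of_le h0 (sub_nonpos.1 h)
        rw [norm_smul, Real.norm_of_nonneg ht0] at h2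
        nlinarith [hf.isStarProjection.norm_le]
    rcases (norm_nonneg a).eq_or_lt with h | h
    · rw [← h, zero_smul]; exact h0
    · have hcl : IsClosed {t : ℝ | t • f ≤ a} :=
        isClosed_le (by fun_prop) continuous_const
      have hsub : Set.Ico 0 ‖a‖ ⊆ {t : ℝ | t • f ≤ a} := fun t ht => key t ht.1 ht.2
      have := hcl.closure_subset_iff.2 hsub
      rw [closure_Ico h.ne] at this
      exact this ⟨norm_nonneg a, le_rfl⟩

theorem IsMinimalProjection.exists_eq_smul {f a : H →L[ℂ] H} (hf : M.IsMinimalProjection f)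
    (ha : a ∈ M) (hfa : f * a = a) (haf : a * f = a) : ∃ c : ℂ, a = c • f := by
  have hfs := hf.isStarProjection.isSelfAdjoint.star_eq
  have self : ∀ b ∈ M, IsSelfAdjoint b → f * b = b → ∃ c : ℂ, b = c • f := by
    intro b hb hs hfb
    rcases hf.nonneg_or_nonpos hb hs hfb with h | h
    · exact ⟨(‖b‖ : ℝ), hf.eq_norm_smul hb h hfb⟩
    · refine ⟨-(‖b‖ : ℝ), ?_⟩
      have := hf.eq_norm_smul (neg_mem hb) (neg_nonneg.2 h) (by rw [mul_neg, hfb])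
      rw [norm_neg] at this
      rw [neg_smul, ← neg_eq_iff_eq_neg]
      exact this
  have hfa' : f * star a = star a := by simpa [hfs] using congr(star $haf)
  obtain ⟨c, hc⟩ := self (a + star a) (add_mem ha (star_mem ha)) (.add_star_self a)
    (by rw [mul_add, hfa, hfa'])
  obtain ⟨d, hd⟩ := self (Complex.I • (a - star a)) (M.complex_smul_mem _ (sub_mem ha (star_mem ha))) (by
    simp [IsSelfAdjoint, ← smul_neg]) (by rw [mul_smul_comm, mul_sub, hfa, hfa'])
  refine ⟨2⁻¹ * c + -2⁻¹ * Complex.I * d, ?_⟩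
  rw [add_smul, mul_smul, mul_smul (_ * _), ← hc, ← hd, smul_smul, mul_assoc, Complex.I_mul_I]
  module

theorem IsMinimalProjection.exists_span {r q : H →L[ℂ] H} (hr : M.IsMinimalProjection r)
    (hq : M.IsMinimalProjection q) :
    ∃ v ∈ M, ∀ x ∈ M, ∃ c : ℂ, r * x * q = c • v := by
  by_cases h : ∀ x ∈ M, r * x * q = 0
  · exact ⟨0, zero_mem M, fun x hx => ⟨0, by simp [h x hx]⟩⟩
  push Not at h
  obtain ⟨y, hy, hne⟩ := h
  have hrs := hr.isStarProjection.isSelfAdjoint.star_eq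
  have hqs := hq.isStarProjection.isSelfAdjoint.star_eq
  have hrr := hr.isStarProjection.isIdempotentElem.eq
  have hqq := hq.isStarProjection.isIdempotentElem.eq
  set v := r * y * q with hv
  have hvM : v ∈ M := mul_mem (mul_mem hr.mem hy) hq.mem
  have hrv : r * v = v := by rw [hv, ← mul_assoc, ← mul_assoc, hrr]
  have hvq : v * q = v := by rw [hv, mul_assoc, hqq]
  have hqv : q * star v = star v := by simpa [hqs] using congr(star $hvq)
  have hvr : star v * r = star v := by simpa [hrs] using congr(star $hrv)
  obtain ⟨l, hl⟩ := hr.exists_eq_smul (mul_mem hvM (star_mem hvM))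
    (by rw [← mul_assoc, hrv]) (by rw [mul_assoc, hvr])
  have hl0 : l ≠ 0 := by
    rintro rfl
    rw [zero_smul, CStarRing.mul_star_self_eq_zero_iff] at hl
    exact hne hl
  refine ⟨v, hvM, fun x hx => ?_⟩
  obtain ⟨c, hc⟩ := hq.exists_eq_smul (a := star v * x * q)
    (mul_mem (mul_mem (star_mem hvM) hx) hq.mem)
    (by rw [← mul_assoc, ← mul_assoc, hqv]) (by rw [mul_assoc, hqq])
  refine ⟨l⁻¹ * c, ?_⟩
  have h1 : l • (r * x * q) = c • v := by
    calc l • (r * x * q) = (l • r) * x * q := by simp only [smul_mul_assoc]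
      _ = v * (star v * x * q) := by rw [← hl]; simp only [mul_assoc]
      _ = c • v := by rw [hc, mul_smul_comm, hvq]
  rw [mul_smul, ← h1, smul_smul, inv_mul_cancel₀ hl0, one_smul]

end VonNeumannAlgebra

open Filter Topology

theorem LinearMap.exists_norm_le_lt_norm_of_not_continuous {E F : Type*} [NormedAddCommGroup E]
    [NormedSpace ℂ E] [NormedAddCommGroup F] [NormedSpace ℂ F] {L : E →ₗ[ℂ] F}
    (hL : ¬ Continuous L) {ε : ℝ} (hε : 0 < ε) (K : ℝ) : ∃ y, ‖y‖ ≤ ε ∧ K < ‖L y‖ := by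
  by_contra! h
  obtain ⟨C, hC⟩ := L.bound_of_ball_bound hε K fun z hz => h z (mem_ball_zero_iff.1 hz).le
  exact hL (AddMonoidHomClass.continuous_of_bound L C hC)

/-- A gliding hump argument: a linear map that is right linear up to a continuous error over each
member of an orthogonal sequence of projections is continuous on one of the left ideals that the
members generate. -/
theorem LinearMap.exists_continuous_mul_of_orthogonal {A : Type*} [NormedRing A]
    [NormedAlgebra ℂ A] [CompleteSpace A] (T : A →ₗ[ℂ] A) {p : ℕ → A}
    (hp : ∀ n, IsIdempotentElem (p n)) (hnorm : ∀ n, ‖p n‖ ≤ 1)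
    (horth : ∀ m n, m ≠ n → p m * p n = 0)
    (hD : ∀ n, Continuous fun y => T (y * p n) - T y * p n) :
    ∃ n, Continuous fun y => T (y * p n) := by
  by_contra! hdisc
  let R : ℕ → A →ₗ[ℂ] A := fun n => T ∘ₗ LinearMap.mulRight ℂ (p n)
  let D : ℕ → A →L[ℂ] A := fun n => ⟨R n - LinearMap.mulRight ℂ (p n) ∘ₗ T, hD n⟩
  have hDapp : ∀ n y, T (y * p n) = T y * p n + D n y := fun n y => by
    change T (y * p n) = T y * p n + (T (y * p n) - T y * p n)
    abel
  have hex : ∀ n, ∃ y, ‖y‖ ≤ (1 / 2 : ℝ) ^ n ∧ n + ‖D n‖ * 2 < ‖T (y * p n)‖ := fun n =>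
    LinearMap.exists_norm_le_lt_norm_of_not_continuous (L := R n) (hdisc n) (by positivity) _
  choose y hy hlt using hex
  have hb : ∀ n, ‖y n * p n‖ ≤ (1 / 2 : ℝ) ^ n := fun n =>
    (norm_mul_le _ _).trans
      ((mul_le_of_le_one_right (norm_nonneg _) (hnorm n)).trans (hy n))
  have hsum : Summable fun n => y n * p n := .of_norm_bounded summable_geometric_two hb
  set x := ∑' n, y n * p n with hx
  have hxn : ‖x‖ ≤ 2 := tsum_of_norm_bounded hasSum_geometric_two hb
  have hxp : ∀ n, x * p n = y n * p n := by
    intro n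
    rw [hx, ← hsum.tsum_mul_right, tsum_eq_single n]
    · rw [mul_assoc, (hp n).eq]
    · intro m hm
      rw [mul_assoc, horth m n hm, mul_zero]
  obtain ⟨n, hn⟩ := exists_nat_gt ‖T x‖
  have h1 := hlt n
  rw [← hxp n, hDapp] at h1
  have h2 : ‖T x * p n + D n x‖ ≤ ‖T x‖ + ‖D n‖ * 2 :=
    (norm_add_le _ _).trans (add_le_add
      ((norm_mul_le _ _).trans (mul_le_of_le_one_right (norm_nonneg _) (hnorm n)))
      (((D n).le_opNorm x).trans (by gcongr)))
  linarith

namespace VonNeumannAlgebra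

variable {H : Type*} [NormedAddCommGroup H] [InnerProductSpace ℂ H] [CompleteSpace H]
  {M : VonNeumannAlgebra H}

/-- The vectors at which a linear map on `M` is continuous for the strong operator topology. -/
def continuityVectors (T : M.toStarSubalgebra →ₗ[ℂ] M.toStarSubalgebra) : Submodule ℂ H where
  carrier := {ξ | Continuous fun y => (T y : H →L[ℂ] H) ξ}
  add_mem' {ξ η} (hξ hη) := by simpa using! Continuous.add hξ hη
  zero_mem' := by simpa using! continuous_const
  smul_mem' c ξ hξ := by simpa using! Continuous.const_smul hξ c

variable {T : M.toStarSubalgebra →ₗ[ℂ] M.toStarSubalgebra}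

theorem mem_continuityVectors {ξ : H} :
    ξ ∈ continuityVectors T ↔ Continuous fun y => (T y : H →L[ℂ] H) ξ := Iff.rfl

instance : CompleteSpace M.toStarSubalgebra :=
  M.isClosed_toStarSubalgebra.completeSpace_coe

/-- Evaluation of a linear map on `M` at a vector. -/
noncomputable def evalAt (T : M.toStarSubalgebra →ₗ[ℂ] M.toStarSubalgebra) (ξ : H) :
    M.toStarSubalgebra →ₗ[ℂ] H where
  toFun y := (T y : H →L[ℂ] H) ξ
  map_add' := by simp
  map_smul' := by simp

theorem isClosed_continuityVectors : IsClosed (continuityVectors T : Set H) := by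
  refine IsSeqClosed.isClosed fun u ξ hu hlim => ?_
  let g : ℕ → M.toStarSubalgebra →L[ℂ] H := fun n => ⟨evalAt T (u n), hu n⟩
  have h : Tendsto (fun n y => g n y) atTop (𝓝 fun y => (T y : H →L[ℂ] H) ξ) :=
    tendsto_pi_nhds.2 fun y => ((T y : H →L[ℂ] H).continuous.tendsto ξ).comp hlim
  exact (continuousLinearMapOfTendsto g h).continuous

theorem continuous_of_continuityVectors_eq_top (h : continuityVectors T = ⊤) : Continuous T := by
  obtain ⟨C, hC⟩ := banach_steinhaus
    (g := fun y : {y : M.toStarSubalgebra // ‖y‖ ≤ 1} => (T y : H →L[ℂ] H)) (by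
      intro ξ
      let L : M.toStarSubalgebra →L[ℂ] H :=
        ⟨evalAt T ξ, mem_continuityVectors.1 (h ▸ Submodule.mem_top)⟩
      exact ⟨‖L‖, fun y => (L.le_opNorm y).trans (mul_le_of_le_one_right (norm_nonneg _) y.2)⟩)
  obtain ⟨K, hK⟩ := T.bound_of_ball_bound one_pos C fun z hz =>
    hC ⟨z, (mem_ball_zero_iff.1 hz).le⟩
  exact AddMonoidHomClass.continuous_of_bound T K hK

theorem starProjection_continuityVectors_mem [(continuityVectors T).HasOrthogonalProjection] :
    (continuityVectors T).starProjection ∈ M := by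
  rw [IsStarProjection.mem_iff isStarProjection_starProjection]
  intro y hy
  rw [Submodule.range_starProjection, Module.End.mem_invtSubmodule]
  intro ξ hξ
  have : ∀ x, (T x : H →L[ℂ] H) (y ξ) = y ((T x : H →L[ℂ] H) ξ) := fun x =>
    congr($(mem_commutant_iff.1 hy _ (T x).2) ξ)
  change Continuous fun x => (T x : H →L[ℂ] H) (y ξ)
  simpa only [this] using! y.continuous.comp hξ

theorem commute_starProjection_continuityVectors
    [(continuityVectors T).HasOrthogonalProjection]
    (hD : ∀ p : M.toStarSubalgebra, IsStarProjection p → Continuous fun y => T (y * p) - T y * p)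
    {p : M.toStarSubalgebra} (hp : IsStarProjection p) :
    Commute (continuityVectors T).starProjection (p : H →L[ℂ] H) := by
  set z := (continuityVectors T).starProjection with hz
  have hzp : IsStarProjection z := isStarProjection_starProjection
  have hinv : ∀ ξ ∈ continuityVectors T, (p : H →L[ℂ] H) ξ ∈ continuityVectors T := by
    intro ξ hξ
    have h1 : Continuous fun y => (T (y * p) : H →L[ℂ] H) ξ :=
      hξ.comp (continuous_mul_const p)
    have h2 : Continuous fun y => ((T (y * p) - T y * p : M.toStarSubalgebra) : H →L[ℂ] H) ξ :=
      (continuous_subtype_val.comp (hD p hp)).clm_apply continuous_const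
    change Continuous fun y => (T y : H →L[ℂ] H) ((p : H →L[ℂ] H) ξ)
    refine (h1.sub h2).congr fun y => ?_
    simp
  have key : z * p * z = p * z := by
    ext ξ
    exact Submodule.starProjection_eq_self_iff.2 (hinv _ (Submodule.starProjection_apply_mem _ _))
  have hps : star (p : H →L[ℂ] H) = p := congr(($(hp.isSelfAdjoint.star_eq) : H →L[ℂ] H))
  have := congr(star $key)
  simp only [star_mul, hps, hzp.isSelfAdjoint.star_eq, ← mul_assoc] at this
  exact this.symm.trans key

end VonNeumannAlgebra

namespace VonNeumannAlgebra

variable {H : Type*} [NormedAddCommGroup H] [InnerProductSpace ℂ H] [CompleteSpace H]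
  {M : VonNeumannAlgebra H} {T : M.toStarSubalgebra →ₗ[ℂ] M.toStarSubalgebra}
  {e : M.toStarSubalgebra}

/-- Strict domination of projections is well founded below a projection under which `T` is
discontinuous on the left ideal generated by every nonzero projection. -/
theorem wellFounded_isStarProjection_below
    (hD : ∀ p : M.toStarSubalgebra, IsStarProjection p → Continuous fun y => T (y * p) - T y * p)
    (hT : ∀ p : M.toStarSubalgebra, IsStarProjection p → e * p = p →
      (Continuous fun y => T (y * p)) → p = 0) :
    WellFounded fun q p : {p : M.toStarSubalgebra // IsStarProjection p ∧ e * p = p} =>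
      p.1 * q.1 = q.1 ∧ q.1 ≠ p.1 := by
  rw [wellFounded_iff_isEmpty_descending_chain]
  refine ⟨fun ⟨f, hf⟩ => ?_⟩
  have hmul : ∀ {m n}, m ≤ n → (f m).1 * (f n).1 = (f n).1 := by
    intro m n hmn
    induction n, hmn using Nat.le_induction with
    | base => exact (f m).2.1.isIdempotentElem.eq
    | succ n _ ih => rw [← (hf n).1, ← mul_assoc, ih]
  have hmul' : ∀ {m n}, m ≤ n → (f n).1 * (f m).1 = (f n).1 := by
    intro m n hmn
    have := congr(star $(hmul hmn))
    rwa [star_mul, (f m).2.1.isSelfAdjoint.star_eq, (f n).2.1.isSelfAdjoint.star_eq] at this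
  have hp : ∀ n, IsStarProjection ((f n).1 - (f (n + 1)).1) := fun n =>
    (f (n + 1)).2.1.sub_of_mul_eq_right (f n).2.1 (hf n).1
  have horth : ∀ m n, m ≠ n →
      ((f m).1 - (f (m + 1)).1) * ((f n).1 - (f (n + 1)).1) = 0 := by
    intro m n hmn
    rcases lt_or_gt_of_ne hmn with h | h
    · rw [sub_mul, mul_sub, mul_sub, hmul h.le, hmul (h.le.trans n.le_succ), hmul h,
        hmul (Nat.succ_le_of_lt h |>.trans n.le_succ), sub_self]
    · rw [sub_mul, mul_sub, mul_sub, hmul' h.le, hmul' h, hmul' (h.le.trans m.le_succ),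
        hmul' (Nat.succ_le_of_lt h |>.trans m.le_succ), sub_self, sub_self, sub_self]
  obtain ⟨n, hn⟩ := T.exists_continuous_mul_of_orthogonal (fun n => (hp n).isIdempotentElem)
    (fun n => (hp n).norm_le) horth fun n => hD _ (hp n)
  exact (hf n).2 (sub_eq_zero.1
    (hT _ (hp n) (by rw [mul_sub, (f n).2.2, (f (n + 1)).2.2]) hn)).symm

theorem IsMinimalProjection.continuous_map_mul_mul {r q : M.toStarSubalgebra}
    (hr : M.IsMinimalProjection r) (hq : M.IsMinimalProjection q) :
    Continuous fun x => T (r * x * q) := by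
  obtain ⟨v, hv, h⟩ := hr.exists_span hq
  let V := Submodule.span ℂ {(⟨v, hv⟩ : M.toStarSubalgebra)}
  have hmem : ∀ x, r * x * q ∈ V := fun x => by
    obtain ⟨c, hc⟩ := h x x.2
    exact Submodule.mem_span_singleton.2 ⟨c, Subtype.ext hc.symm⟩
  exact (T ∘ₗ V.subtype).continuous_of_finiteDimensional.comp
    (Continuous.subtype_mk (p := (· ∈ V)) (f := fun x => r * x * q) (by fun_prop) hmem)

theorem isMinimalProjection_of_forall {q : M.toStarSubalgebra} (hq : IsStarProjection q)
    (h : ∀ p : M.toStarSubalgebra, IsStarProjection p → q * p = p → p = 0 ∨ p = q) :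
    M.IsMinimalProjection q where
  mem := q.2
  isStarProjection := hq.map M.toStarSubalgebra.subtype
  eq_zero_or_eq p hp hps hqp := by
    simpa [Subtype.ext_iff] using h ⟨p, hp⟩
      ⟨Subtype.ext hps.isIdempotentElem.eq, Subtype.ext hps.isSelfAdjoint.star_eq⟩ (Subtype.ext hqp)

theorem eq_zero_of_continuous_map_mul_imp_eq_zero
    (hD : ∀ p : M.toStarSubalgebra, IsStarProjection p → Continuous fun y => T (y * p) - T y * p)
    (he : IsStarProjection e) (hcomm : ∀ x, Commute e x)
    (hT : ∀ p : M.toStarSubalgebra, IsStarProjection p → e * p = p →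
      (Continuous fun y => T (y * p)) → p = 0) : e = 0 := by
  by_contra h0
  have hwf := wellFounded_isStarProjection_below hD hT
  obtain ⟨⟨q, hq, heq⟩, hq0, hmin⟩ := hwf.has_min {p | p.1 ≠ 0}
    ⟨⟨e, he, he.isIdempotentElem.eq⟩, h0⟩
  have hqmin : M.IsMinimalProjection q := by
    refine isMinimalProjection_of_forall hq fun p hp hqp => ?_
    by_contra! h
    exact hmin ⟨p, hp, by rw [← hqp, ← mul_assoc, heq]⟩ h.1 ⟨hqp, h.2⟩
  have key : ∀ r : {p : M.toStarSubalgebra // IsStarProjection p ∧ e * p = p},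
      Continuous fun x => T (r.1 * x * q) := by
    intro r
    induction r using hwf.induction with
    | _ r ih =>
    by_cases hr : ∀ p : M.toStarSubalgebra, IsStarProjection p → r.1 * p = p → p = 0 ∨ p = r.1
    · exact (isMinimalProjection_of_forall r.2.1 hr).continuous_map_mul_mul hqmin
    push Not at hr
    obtain ⟨p, hp, hrp, hp0, hpr⟩ := hr
    have hep : e * p = p := by rw [← hrp, ← mul_assoc, r.2.2]
    have h1 := ih ⟨p, hp, hep⟩ ⟨hrp, hpr⟩
    have h2 := ih ⟨r.1 - p, hp.sub_of_mul_eq_right r.2.1 hrp, by rw [mul_sub, r.2.2, hep]⟩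
      ⟨by rw [mul_sub, r.2.1.isIdempotentElem.eq, hrp], by simpa using hp0⟩
    refine (h1.add h2).congr fun x => ?_
    rw [Pi.add_apply, ← map_add, ← add_mul, ← add_mul, add_sub_cancel]
  refine hq0 (hT q hq heq ((key ⟨e, he, he.isIdempotentElem.eq⟩).congr fun x => ?_))
  rw [(hcomm x).eq, mul_assoc, heq]

/-- A linear map on a von Neumann algebra that is right linear up to a continuous error over each
projection is continuous. -/
theorem continuous_of_forall_isStarProjection
    (hD : ∀ p : M.toStarSubalgebra, IsStarProjection p → Continuous fun y => T (y * p) - T y * p) :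
    Continuous T := by
  have : CompleteSpace (continuityVectors T) := isClosed_continuityVectors.completeSpace_coe
  let z : M.toStarSubalgebra :=
    ⟨(continuityVectors T).starProjection, starProjection_continuityVectors_mem⟩
  have hz : IsStarProjection z :=
    ⟨Subtype.ext (isStarProjection_starProjection (U := continuityVectors T)).isIdempotentElem.eq,
      Subtype.ext (isStarProjection_starProjection (U := continuityVectors T)).isSelfAdjoint.star_eq⟩
  have hcomm : ∀ x, Commute z x := fun x => Subtype.ext
    (M.commute_of_forall_isStarProjection (fun p hp hps =>
      commute_starProjection_continuityVectors (p := ⟨p, hp⟩) hD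
        ⟨Subtype.ext hps.isIdempotentElem.eq, Subtype.ext hps.isSelfAdjoint.star_eq⟩) x.2).eq
  have h := eq_zero_of_continuous_map_mul_imp_eq_zero hD hz.one_sub
    (fun x => (Commute.one_left x).sub_left (hcomm x)) fun p hp hzp hcont => by
      have hTp : Continuous fun y => T y * p := (hcont.sub (hD p hp)).congr fun y => sub_sub_cancel _ _
      have hrange : ∀ ξ, (p : H →L[ℂ] H) ξ ∈ continuityVectors T := fun ξ =>
        (continuous_subtype_val.comp hTp).clm_apply continuous_const
      have hzp' : z * p = p := Subtype.ext <| ContinuousLinearMap.ext fun ξ =>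
        Submodule.starProjection_eq_self_iff.2 (hrange ξ)
      rw [← hzp, sub_mul, one_mul, hzp', sub_self]
  apply continuous_of_continuityVectors_eq_top
  rw [eq_top_iff]
  intro ξ _
  have hz1 : (continuityVectors T).starProjection = 1 :=
    congr(($((sub_eq_zero.1 h).symm) : H →L[ℂ] H))
  exact Submodule.starProjection_eq_self_iff.1 (by rw [hz1]; rfl)

end VonNeumannAlgebra

section ZeroProducts

/-- The defect of right linearity over an idempotent of a derivation at zero. -/
theorem map_mul_sub_of_derivation_at_zero {A : Type*} [Ring A] [Algebra ℂ A] {T : A →ₗ[ℂ] A}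
    (hT : ∀ a b : A, a * b = 0 → T a * b + a * T b = 0) {p : A} (hp : IsIdempotentElem p) (y : A) :
    T (y * p) - T y * p = y * T p - y * p * T 1 := by
  have h1 := hT (y * p) (1 - p) (by rw [mul_assoc, mul_sub, hp.eq]; simp)
  have h2 := hT (y - y * p) p (by rw [sub_mul, mul_assoc, hp.eq, sub_self])
  simp only [map_sub, mul_sub, sub_mul, mul_one] at h1 h2
  rw [← sub_eq_zero, ← sub_eq_zero.2 (h1.trans h2.symm)]
  abel

/-- A linear map which is a derivation for the triple product on triples with zero product. -/
def IsTripleDerivationAtZero {A : Type*} [Ring A] [StarRing A] [Algebra ℂ A]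
    (T : A →ₗ[ℂ] A) : Prop :=
  ∀ a b c : A, trip a b c = 0 → trip (T a) b c + trip a (T b) c + trip a b (T c) = 0

namespace IsTripleDerivationAtZero

section Algebra

variable {A : Type*} [Ring A] [StarRing A] [Algebra ℂ A] {T : A →ₗ[ℂ] A} {p q a c : A}

theorem expand (hT : IsTripleDerivationAtZero T) {a b c : A}
    (h : a * star b * c + c * star b * a = 0) :
    T a * star b * c + c * star b * T a + (a * star (T b) * c + c * star (T b) * a) +
      (a * star b * T c + T c * star b * a) = 0 := by
  have := hT a b c (by simp [trip, h])
  simpa [trip, ← smul_add] using this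

/-- The image of an element of the corner orthogonal to `q`, cut down by `q` on the right. -/
theorem map_corner_mul (hT : IsTripleDerivationAtZero T) (hq : IsStarProjection q)
    (hqa : q * a = 0) (haq : a * q = 0) : T a * q = -(a * star (T q) * q) := by
  have hqq := hq.isIdempotentElem.eq
  have hqq' : ∀ x, q * (q * x) = q * x := fun x => by rw [← mul_assoc, hqq]
  have hqa' : ∀ x, q * (a * x) = 0 := fun x => by rw [← mul_assoc, hqa, zero_mul]
  have haq' : ∀ x, a * (q * x) = 0 := fun x => by rw [← mul_assoc, haq, zero_mul]
  have h := hT.expand (a := a) (b := q) (c := q)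
    (by simp [hq.isSelfAdjoint.star_eq, mul_assoc, hqa, haq'])
  simp only [hq.isSelfAdjoint.star_eq, mul_assoc, hqq, hqa, haq', mul_zero, add_zero] at h
  have h1 := congr(q * $h * q)
  simp only [mul_add, add_mul, mul_assoc, hqq, hqq', hqa', haq, mul_zero, zero_mul,
    add_zero] at h1
  have h2 : q * (T a * q) = 0 := by
    rw [← two_smul ℂ] at h1
    exact (smul_eq_zero_iff_right two_ne_zero).1 h1
  have h3 := congr($h * q)
  simp only [add_mul, mul_assoc, hqq, haq, h2, mul_zero, zero_mul, add_zero] at h3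
  rw [mul_assoc]
  exact eq_neg_of_add_eq_zero_left h3

theorem map_mul_add_map_mul (hT : IsTripleDerivationAtZero T) (hp : IsStarProjection p)
    (hqp : q * p = 0) (hpa : p * a = a) (hpc : p * c = c) (hap : a * p = 0) (hcp : c * p = 0) :
    q * T a * c + q * T c * a = 0 := by
  have hqa : q * a = 0 := by rw [← hpa, ← mul_assoc, hqp, zero_mul]
  have hqc : q * c = 0 := by rw [← hpc, ← mul_assoc, hqp, zero_mul]
  have hqa' : ∀ x, q * (a * x) = 0 := fun x => by rw [← mul_assoc, hqa, zero_mul]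
  have hqc' : ∀ x, q * (c * x) = 0 := fun x => by rw [← mul_assoc, hqc, zero_mul]
  have h := hT.expand (a := a) (b := p) (c := c)
    (by simp [hp.isSelfAdjoint.star_eq, hap, hcp])
  have h1 := congr(q * $h)
  simpa only [hp.isSelfAdjoint.star_eq, mul_add, mul_assoc, hpa, hpc, hqa', hqc', mul_zero,
    zero_mul, add_zero, zero_add] using h1

theorem mul_map_add_mul_map (hT : IsTripleDerivationAtZero T) (hq : IsStarProjection q)
    (hqp : q * p = 0) (haq : a * q = a) (hcq : c * q = c) (hqa : q * a = 0) (hqc : q * c = 0) :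
    c * T a * p + a * T c * p = 0 := by
  have hap : a * p = 0 := by rw [← haq, mul_assoc, hqp, mul_zero]
  have hcp : c * p = 0 := by rw [← hcq, mul_assoc, hqp, mul_zero]
  have haq' : ∀ x, a * (q * x) = a * x := fun x => by rw [← mul_assoc, haq]
  have hcq' : ∀ x, c * (q * x) = c * x := fun x => by rw [← mul_assoc, hcq]
  have h := hT.expand (a := a) (b := q) (c := c)
    (by simp [hq.isSelfAdjoint.star_eq, mul_assoc, hqa, hqc])
  have h1 := congr($h * p)
  simpa only [hq.isSelfAdjoint.star_eq, add_mul, mul_assoc, hqa, hqc, haq', hcq', hap, hcp,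
    mul_zero, zero_mul, add_zero, zero_add] using h1

theorem corner_map_offDiagonal (hT : IsTripleDerivationAtZero T) (hpp : p * p = p)
    (hpq : p * q = 0) (hqp : q * p = 0) (hpa : p * a = a) (haq : a * q = a) :
    p * T a * p = -((2 : ℂ)⁻¹ • (a * (star (T 1) + T (p - q)) * p)) := by
  have hap : a * p = 0 := by rw [← haq, mul_assoc, hqp, mul_zero]
  have hqa : q * a = 0 := by rw [← hpa, ← mul_assoc, hqp, zero_mul]
  have hpp' : ∀ x, p * (p * x) = p * x := fun x => by rw [← mul_assoc, hpp]
  have hpq' : ∀ x, p * (q * x) = 0 := fun x => by rw [← mul_assoc, hpq, zero_mul]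
  have hpa' : ∀ x, p * (a * x) = a * x := fun x => by rw [← mul_assoc, hpa]
  have h := hT.expand (a := a) (b := 1) (c := p - q)
    (by simp [mul_sub, sub_mul, hpa, haq, hap, hqa])
  have h1 := congr(p * $h * p)
  simp only [star_one, mul_one, mul_add, add_mul, mul_sub, sub_mul, mul_assoc, hpp, hqp, hpp',
    hpq', hpa', hap, mul_zero, zero_mul, add_zero, sub_zero] at h1
  rw [← two_smul ℂ, add_assoc, ← mul_add] at h1
  rw [mul_assoc, mul_assoc, add_mul, ← smul_neg, ← eq_neg_of_add_eq_zero_left h1, smul_smul,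
    inv_mul_cancel₀ two_ne_zero, one_smul]

end Algebra

section CStar

variable {A : Type*} [NormedRing A] [StarRing A] [CStarRing A] [NormedAlgebra ℂ A]
  {T : A →ₗ[ℂ] A} {p q a : A}

theorem opposite_corner_map_offDiagonal (hT : IsTripleDerivationAtZero T)
    (hp : IsStarProjection p) (hq : IsStarProjection q)
    (hqp : q * p = 0) (hpa : p * a = a) (haq : a * q = a) : q * T a * p = 0 := by
  have hps := hp.isSelfAdjoint.star_eq
  have hqs := hq.isSelfAdjoint.star_eq
  have hap : a * p = 0 := by rw [← haq, mul_assoc, hqp, mul_zero]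
  have hqa : q * a = 0 := by rw [← hpa, ← mul_assoc, hqp, zero_mul]
  set F := q * T a * p with hF
  have hFs : star F = p * star (T a) * q := by simp [hF, hps, hqs, mul_assoc]
  have hpF : p * star F = star F := by
    rw [hFs, ← mul_assoc, ← mul_assoc, hp.isIdempotentElem.eq]
  have hFp : star F * p = 0 := by rw [hFs, mul_assoc, hqp, mul_zero]
  have h1 := hT.map_mul_add_map_mul hp hqp hpa hpF hap hFp
  have h2 := hT.mul_map_add_mul_map hq hqp haq haq hqa hqa
  have haF : a * F = 0 := by
    rw [← two_smul ℂ] at h2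
    have := (smul_eq_zero_iff_right two_ne_zero).1 h2
    rw [hF, mul_assoc q, ← mul_assoc, haq, ← mul_assoc, this]
  have hFa : star F * star a = 0 := by simpa using congr(star $haF)
  have hFF : q * T a * star F = F * star F := by
    rw [hF, mul_assoc _ p, hpF]
  rw [hFF] at h1
  set G := q * T (star F) * a with hG
  have h3 : G * star a = 0 := by
    have := congr($h1 * star a)
    rwa [add_mul, mul_assoc F, hFa, mul_zero, zero_add, zero_mul] at this
  have hG0 : G = 0 := by
    rw [← CStarRing.mul_star_self_eq_zero_iff]
    have hGs : star G = star a * star (q * T (star F)) := star_mul _ _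
    rw [hGs, ← mul_assoc, h3, zero_mul]
  rw [hG0, add_zero] at h1
  exact (CStarRing.mul_star_self_eq_zero_iff F).1 h1

theorem map_offDiagonal_mul (hT : IsTripleDerivationAtZero T) (hp : IsStarProjection p)
    (hq : IsStarProjection q) (hpq : p * q = 0) (hqp : q * p = 0) (hadd : p + q = 1)
    (hpa : p * a = a) (haq : a * q = a) :
    T a * p = -((2 : ℂ)⁻¹ • (a * (star (T 1) + T (p - q)) * p)) := by
  rw [← hT.corner_map_offDiagonal hp.isIdempotentElem.eq hpq hqp hpa haq,
    ← add_zero (p * T a * p), ← hT.opposite_corner_map_offDiagonal hp hq hqp hpa haq, ← add_mul,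
    ← add_mul, hadd, one_mul]

theorem continuous_map_mul_sub (hT : IsTripleDerivationAtZero T) (hp : IsStarProjection p) :
    Continuous fun y => T (y * p) - T y * p := by
  obtain ⟨q, hq⟩ : ∃ q, q = 1 - p := ⟨_, rfl⟩
  have hadd : p + q = 1 := by rw [hq, add_sub_cancel]
  have hpq : p * q = 0 := by rw [hq]; exact hp.mul_one_sub_self
  have hqp : q * p = 0 := by rw [hq]; exact hp.one_sub_mul_self
  have hqproj : IsStarProjection q := by rw [hq]; exact hp.one_sub
  have hpp := hp.isIdempotentElem.eq
  have hqq := hqproj.isIdempotentElem.eq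
  have hpp' : ∀ x, p * (p * x) = p * x := fun x => by rw [← mul_assoc, hpp]
  have hqq' : ∀ x, q * (q * x) = q * x := fun x => by rw [← mul_assoc, hqq]
  have hpq' : ∀ x, p * (q * x) = 0 := fun x => by rw [← mul_assoc, hpq, zero_mul]
  have hqp' : ∀ x, q * (p * x) = 0 := fun x => by rw [← mul_assoc, hqp, zero_mul]
  have key : ∀ y, T (y * p) - T y * p = T (p * y * p) * q + T (q * y * p) * q -
      T (p * y * q) * p - T (q * y * q) * p := by
    intro y
    have e1 : y * p = p * y * p + q * y * p := by rw [← add_mul, ← add_mul, hadd, one_mul]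
    have e2 : y = p * y * p + q * y * p + (p * y * q + q * y * q) := by
      rw [← e1, ← add_mul, ← add_mul, hadd, one_mul, ← mul_add, hadd, mul_one]
    have e3 : q = 1 - p := hq
    conv_lhs => rw [e1]; enter [2, 1, 2]; rw [e2]
    rw [map_add, map_add, map_add, map_add]
    generalize T (p * y * p) = t₁
    generalize T (q * y * p) = t₂
    generalize T (p * y * q) = t₃
    generalize T (q * y * q) = t₄
    rw [e3]
    noncomm_ring
  have h1 : ∀ y, T (p * y * p) * q = -(p * y * p * star (T q) * q) := fun y =>
    hT.map_corner_mul hqproj (by simp [mul_assoc, hqp']) (by simp [mul_assoc, hpq])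
  have h2 : ∀ y, T (q * y * q) * p = -(q * y * q * star (T p) * p) := fun y =>
    hT.map_corner_mul hp (by simp [mul_assoc, hpq']) (by simp [mul_assoc, hqp])
  have h3 : ∀ y, T (p * y * q) * p =
      -((2 : ℂ)⁻¹ • (p * y * q * (star (T 1) + T (p - q)) * p)) := fun y =>
    hT.map_offDiagonal_mul hp hqproj hpq hqp hadd (by simp [mul_assoc, hpp'])
      (by simp [mul_assoc, hqq])
  have h4 : ∀ y, T (q * y * p) * q =
      -((2 : ℂ)⁻¹ • (q * y * p * (star (T 1) + T (q - p)) * q)) := fun y =>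
    hT.map_offDiagonal_mul hqproj hp hqp hpq (by rw [add_comm, hadd]) (by simp [mul_assoc, hqq'])
      (by simp [mul_assoc, hpp])
  simp only [key, h1, h2, h3, h4]
  fun_prop

end CStar

end IsTripleDerivationAtZero

end ZeroProducts

/-- A linear map on a von Neumann algebra which is either a derivation at zero or a triple
derivation at zero is continuous. -/
theorem stmt13 {H : Type*} [NormedAddCommGroup H] [InnerProductSpace ℂ H] [CompleteSpace H]
    (M : VonNeumannAlgebra H)
    (T : M.toStarSubalgebra →ₗ[ℂ] M.toStarSubalgebra)
    (hT : (∀ a b : M.toStarSubalgebra, a * b = 0 → T a * b + a * T b = 0) ∨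
      (∀ a b c : M.toStarSubalgebra, trip a b c = 0 →
        trip (T a) b c + trip a (T b) c + trip a b (T c) = 0)) :
    Continuous T := by
  refine VonNeumannAlgebra.continuous_of_forall_isStarProjection fun p hp => ?_
  rcases hT with hT | hT
  · simp only [map_mul_sub_of_derivation_at_zero hT hp.isIdempotentElem]
    fun_prop
  · exact IsTripleDerivationAtZero.continuous_map_mul_sub hT hp
end

section
/- Let M be a von Neumann algebra and let δ : M → M be a linear map (not assumed continuous) which is a derivation at zero. Then δ is a continuous generalized derivation, i.e., δ is continuous and δ(xy) = δ(x)y + xδ(y) − xδ(1)y for all x, y ∈ M. If additionally δ(1) = 0, then δ is a derivation. -/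
open Filter Topology

/-- A Rickart C⋆-algebra: every right annihilator of an element is generated, as a right ideal,
by a projection. -/
def IsRickartCStar (A : Type*) [CStarAlgebra A] : Prop :=
  ∀ a : A, ∃ e : A, IsStarProjection e ∧ ∀ y : A, a * y = 0 ↔ e * y = y

/-- An additive subgroup `K` such that every element of an additive subgroup `G` can be
approximated by `K ⊓ G` up to half of its norm is dense in `G`. -/
lemma mem_closure_of_norm_sub_le_half {E : Type*} [SeminormedAddCommGroup E]
    (G K : AddSubgroup E) (h : ∀ x ∈ G, ∃ w ∈ K, w ∈ G ∧ ‖x - w‖ ≤ ‖x‖ / 2)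
    {x : E} (hx : x ∈ G) : x ∈ closure (K : Set E) := by
  have key : ∀ n : ℕ, ∃ w ∈ K, w ∈ G ∧ ‖x - w‖ ≤ ‖x‖ * (1 / 2) ^ n := by
    intro n
    induction n with
    | zero => exact ⟨0, K.zero_mem, G.zero_mem, by simp⟩
    | succ n ih =>
      obtain ⟨w, hwK, hwG, hw⟩ := ih
      obtain ⟨v, hvK, hvG, hv⟩ := h _ (G.sub_mem hx hwG)
      refine ⟨w + v, K.add_mem hwK hvK, G.add_mem hwG hvG, ?_⟩
      rw [← sub_sub, pow_succ]
      linarith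
  rw [Metric.mem_closure_iff]
  intro ε hε
  have hlim : Tendsto (fun n : ℕ ↦ ‖x‖ * (1 / 2 : ℝ) ^ n) atTop (𝓝 0) := by
    simpa using (tendsto_pow_atTop_nhds_zero_of_lt_one (r := (1 / 2 : ℝ))
      (by norm_num) (by norm_num)).const_mul ‖x‖
  obtain ⟨n, hn⟩ := (hlim.eventually_lt_const hε).exists
  obtain ⟨w, hwK, -, hw⟩ := key n
  exact ⟨w, hwK, by rw [dist_eq_norm]; exact hw.trans_lt hn⟩

section CStar

variable {A : Type*} [CStarAlgebra A]

lemma norm_sub_smul_one_le [PartialOrder A] [StarOrderedRing A] {a : A} (ha : 0 ≤ a) {c : ℝ}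
    (hc : ‖a‖ ≤ 2 * c) : ‖a - c • (1 : A)‖ ≤ c := by
  have hc0 : 0 ≤ c := by linarith [norm_nonneg a]
  have hsa : IsSelfAdjoint a := .of_nonneg ha
  have h : cfc (fun t : ℝ ↦ t - c) a = a - c • (1 : A) := by
    rw [cfc_sub (fun t ↦ t) (fun _ ↦ c) a, cfc_id' ℝ a, cfc_const c a,
      Algebra.algebraMap_eq_smul_one]
  rw [← h]
  refine norm_cfc_le hc0 fun t ht ↦ ?_
  have h0 : 0 ≤ t := spectrum_nonneg_of_nonneg ha ht
  have h1 : ‖t‖ ≤ ‖a‖ := IsometricContinuousFunctionalCalculus.norm_spectrum_le a ht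
  rw [Real.norm_eq_abs, abs_le] at *
  constructor <;> linarith

/-- Spectral projections in a Rickart C⋆-algebra: `x` is approximated by the multiple `‖x‖ / 2`
of the symmetry `2 p - 1`, where `p` is the support of the positive part of `x`. -/
lemma IsRickartCStar.exists_isStarProjection_norm_sub_le (hA : IsRickartCStar A) {x : A}
    (hx : IsSelfAdjoint x) :
    ∃ p : A, IsStarProjection p ∧ ‖x - (‖x‖ / 2) • (p + p - 1)‖ ≤ ‖x‖ / 2 ∧
      ∀ y : A, y * x = 0 → y * p = 0 := by
  let _ := CStarAlgebra.spectralOrder A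
  let _ := CStarAlgebra.spectralOrderedRing A
  obtain ⟨e, he, hey⟩ := hA x⁺
  have hee : e * e = e := he.isIdempotentElem.eq
  have hes : star e = e := he.isSelfAdjoint.star_eq
  have hpos : star x⁺ = x⁺ := (IsSelfAdjoint.of_nonneg (CFC.posPart_nonneg x)).star_eq
  have hneg : star x⁻ = x⁻ := (IsSelfAdjoint.of_nonneg (CFC.negPart_nonneg x)).star_eq
  have hpe : x⁺ * e = 0 := (hey e).2 hee
  have hen : e * x⁻ = x⁻ := (hey x⁻).1 (CFC.posPart_mul_negPart x)
  have hne : x⁻ * e = x⁻ := by simpa [hes, hneg] using congr(star $hen)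
  have hxx : x⁺ - x⁻ = x := CFC.posPart_sub_negPart x
  refine ⟨1 - e, he.one_sub, ?_, fun y hy ↦ ?_⟩
  · have habs : x⁺ + x⁻ = CFC.abs x := CFC.posPart_add_negPart x
    have hnorm : ‖x⁺ + x⁻ - (‖x‖ / 2) • (1 : A)‖ ≤ ‖x‖ / 2 :=
      norm_sub_smul_one_le (add_nonneg (CFC.posPart_nonneg x) (CFC.negPart_nonneg x))
        (by rw [habs, CFC.norm_abs]; linarith)
    have hsym : ‖(1 - e) + (1 - e) - 1‖ ≤ 1 := by
      have h1 : star ((1 - e) + (1 - e) - 1) * ((1 - e) + (1 - e) - 1) = 1 := by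
        simp only [star_sub, star_add, star_one, hes]
        noncomm_ring
        simp [hee]
      have h2 := CStarRing.norm_star_mul_self (x := (1 - e) + (1 - e) - 1)
      rw [h1] at h2
      have h3 := IsStarProjection.norm_le (1 : A) (.one A)
      nlinarith [norm_nonneg ((1 - e) + (1 - e) - 1)]
    have hfac : x - (‖x‖ / 2) • ((1 - e) + (1 - e) - 1) =
        (x⁺ + x⁻ - (‖x‖ / 2) • (1 : A)) * ((1 - e) + (1 - e) - 1) := by
      rw [sub_mul, smul_mul_assoc, one_mul]
      congr 1
      simp only [mul_sub, mul_add, add_mul, hpe, hne, mul_one]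
      conv_lhs => rw [← hxx]
      abel
    rw [hfac]
    calc _ ≤ _ := norm_mul_le _ _
      _ ≤ ‖x‖ / 2 * 1 := by gcongr
      _ = _ := mul_one _
  · have h0 : (x⁺ - x⁻) * x⁺ = x⁺ * x⁺ := by
      rw [sub_mul, CFC.negPart_mul_posPart x, sub_zero]
    rw [hxx] at h0
    have h1 : y * x⁺ * x⁺ = 0 := by rw [mul_assoc, ← h0, ← mul_assoc, hy, zero_mul]
    have h2 : y * x⁺ = 0 := by
      rw [← CStarRing.mul_star_self_eq_zero_iff, star_mul, hpos, ← mul_assoc, h1, zero_mul]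
    have h3 : e * star y = star y := (hey _).1 (by simpa [hpos] using congr(star $h2))
    have h4 : y * e = y := by simpa [hes] using congr(star $h3)
    rw [mul_sub, h4, mul_one, sub_self]

lemma mem_of_forall_isSelfAdjoint_mem {S : Submodule ℂ A}
    (h : ∀ x : A, IsSelfAdjoint x → x ∈ S) (x : A) : x ∈ S := by
  rw [← realPart_add_I_smul_imaginaryPart x]
  exact S.add_mem (h _ (realPart x).2) (S.smul_mem _ (h _ (imaginaryPart x).2))

/-- A closed subspace of a Rickart C⋆-algebra that contains all projections is everything. -/
lemma IsRickartCStar.mem_of_isClosed (hA : IsRickartCStar A) (S : Submodule ℂ A)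
    (hS : IsClosed (S : Set A)) (hp : ∀ p : A, IsStarProjection p → p ∈ S) (x : A) : x ∈ S := by
  refine mem_of_forall_isSelfAdjoint_mem (fun x hx ↦ ?_) x
  have := mem_closure_of_norm_sub_le_half (selfAdjoint A) S.toAddSubgroup
    (fun x hx ↦ ?_) (x := x) hx
  · rwa [Submodule.coe_toAddSubgroup, hS.closure_eq] at this
  · obtain ⟨p, hpp, hn, -⟩ := hA.exists_isStarProjection_norm_sub_le (x := x) hx
    refine ⟨_, ?_, ?_, hn⟩
    · exact S.smul_of_tower_mem _ (S.sub_mem (S.add_mem (hp p hpp) (hp p hpp)) (hp 1 (.one A)))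
    · exact (IsSelfAdjoint.all (‖x‖ / 2)).smul
        ((hpp.isSelfAdjoint.add hpp.isSelfAdjoint).sub (.one A))

/-- The separating space of a linear map: all limits of `T uₙ` for sequences `uₙ → 0`. -/
noncomputable def separatingSpace (T : A →ₗ[ℂ] A) : Submodule ℂ A :=
  T.graph.topologicalClosure.comap (LinearMap.inr ℂ A A)

lemma mem_separatingSpace_iff {T : A →ₗ[ℂ] A} {z : A} :
    z ∈ separatingSpace T ↔
      ∃ u : ℕ → A, Tendsto u atTop (𝓝 0) ∧ Tendsto (fun n ↦ T (u n)) atTop (𝓝 z) := by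
  rw [separatingSpace, Submodule.mem_comap, ← SetLike.mem_coe, Submodule.topologicalClosure_coe,
    mem_closure_iff_seq_limit]
  constructor
  · rintro ⟨w, hw, hlim⟩
    rw [LinearMap.inr_apply, Prod.tendsto_iff] at hlim
    refine ⟨fun n ↦ (w n).1, hlim.1, ?_⟩
    convert hlim.2 using 2 with n
    exact ((LinearMap.mem_graph_iff T _).1 (hw n)).symm
  · rintro ⟨u, hu, hTu⟩
    exact ⟨fun n ↦ (u n, T (u n)), fun n ↦ (LinearMap.mem_graph_iff T _).2 rfl, hu.prodMk_nhds hTu⟩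

lemma isClosed_separatingSpace (T : A →ₗ[ℂ] A) : IsClosed (separatingSpace T : Set A) :=
  T.graph.isClosed_topologicalClosure.preimage (continuous_const.prodMk continuous_id)

lemma continuous_of_separatingSpace_eq_bot {T : A →ₗ[ℂ] A} (h : separatingSpace T = ⊥) :
    Continuous T := by
  refine T.continuous_of_seq_closed_graph fun u x y hu hTu ↦ ?_
  have : y - T x ∈ separatingSpace T := by
    refine mem_separatingSpace_iff.2 ⟨fun n ↦ u n - x, ?_, ?_⟩
    · simpa using hu.sub_const x
    · simpa using hTu.sub_const (T x)
  rwa [h, Submodule.mem_bot, sub_eq_zero] at this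

/-- Linear maps that differ from a module map for left and right multiplication by each idempotent
only by a multiplication operator. Derivations and generalized derivations have this property. -/
structure IsIdempotentDerivationLike (T : A →ₗ[ℂ] A) : Prop where
  left : ∀ e : A, IsIdempotentElem e → ∃ d : A, ∀ b, T (e * b) = d * b + e * T b
  right : ∀ e : A, IsIdempotentElem e → ∃ d : A, ∀ a, T (a * e) = T a * e + a * d

namespace IsIdempotentDerivationLike

variable {T : A →ₗ[ℂ] A}

lemma tendsto_left (hT : IsIdempotentDerivationLike T) {e z : A} (he : IsIdempotentElem e)
    {u : ℕ → A} (hu : Tendsto u atTop (𝓝 0)) (hTu : Tendsto (fun n ↦ T (u n)) atTop (𝓝 z)) :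
    Tendsto (fun n ↦ e * u n) atTop (𝓝 0) ∧
      Tendsto (fun n ↦ T (e * u n)) atTop (𝓝 (e * z)) := by
  obtain ⟨d, hd⟩ := hT.left e he
  simp only [hd]
  exact ⟨by simpa using hu.const_mul e, by simpa using (hu.const_mul d).add (hTu.const_mul e)⟩

lemma tendsto_right (hT : IsIdempotentDerivationLike T) {e z : A} (he : IsIdempotentElem e)
    {u : ℕ → A} (hu : Tendsto u atTop (𝓝 0)) (hTu : Tendsto (fun n ↦ T (u n)) atTop (𝓝 z)) :
    Tendsto (fun n ↦ u n * e) atTop (𝓝 0) ∧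
      Tendsto (fun n ↦ T (u n * e)) atTop (𝓝 (z * e)) := by
  obtain ⟨d, hd⟩ := hT.right e he
  simp only [hd]
  exact ⟨by simpa using hu.mul_const e, by simpa using (hTu.mul_const e).add (hu.mul_const d)⟩

lemma mul_mem_left (hT : IsIdempotentDerivationLike T) (hA : IsRickartCStar A) (a : A) {z : A}
    (hz : z ∈ separatingSpace T) : a * z ∈ separatingSpace T := by
  refine hA.mem_of_isClosed ((separatingSpace T).comap (LinearMap.mulRight ℂ z))
    ((isClosed_separatingSpace T).preimage (continuous_mul_const z)) (fun p hp ↦ ?_) a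
  obtain ⟨u, hu, hTu⟩ := mem_separatingSpace_iff.1 hz
  exact mem_separatingSpace_iff.2 ⟨_, hT.tendsto_left hp.isIdempotentElem hu hTu⟩

lemma mul_mem_right (hT : IsIdempotentDerivationLike T) (hA : IsRickartCStar A) (a : A) {z : A}
    (hz : z ∈ separatingSpace T) : z * a ∈ separatingSpace T := by
  refine hA.mem_of_isClosed ((separatingSpace T).comap (LinearMap.mulLeft ℂ z))
    ((isClosed_separatingSpace T).preimage (continuous_const_mul z)) (fun p hp ↦ ?_) a
  obtain ⟨u, hu, hTu⟩ := mem_separatingSpace_iff.1 hz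
  exact mem_separatingSpace_iff.2 ⟨_, hT.tendsto_right hp.isIdempotentElem hu hTu⟩

/-- An idempotent generating a one-dimensional corner cannot be a nonzero element of the separating
space. -/
lemma eq_zero_of_corner (hT : IsIdempotentDerivationLike T) {e : A} (he : IsIdempotentElem e)
    (hmem : e ∈ separatingSpace T) (hcorner : ∀ x, ∃ c : ℂ, e * x * e = c • e) : e = 0 := by
  by_contra hne
  obtain ⟨u, hu, hTu⟩ := mem_separatingSpace_iff.1 hmem
  obtain ⟨hu, hTu⟩ := hT.tendsto_left he hu hTu
  obtain ⟨hu, hTu⟩ := hT.tendsto_right he hu hTu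
  choose c hc using hcorner
  simp only [hc, map_smul, he.eq] at hu hTu
  have hc0 : Tendsto (fun n ↦ c (u n)) atTop (𝓝 0) := by
    rw [tendsto_zero_iff_norm_tendsto_zero] at hu ⊢
    simpa [norm_smul, hne] using hu.mul_const ‖e‖⁻¹
  have h0 : Tendsto (fun n ↦ c (u n) • T e) atTop (𝓝 0) := by simpa using hc0.smul_const (T e)
  exact hne (tendsto_nhds_unique hTu h0)

/-- If `q` does not annihilate the separating space of `T`, then `x ↦ q * T x` is unbounded. -/
lemma exists_norm_le_lt_norm {q s : A} (hs : s ∈ separatingSpace T) (hqs : q * s ≠ 0)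
    {ε : ℝ} (hε : 0 < ε) (C : ℝ) : ∃ x : A, ‖x‖ ≤ ε ∧ C < ‖q * T x‖ := by
  obtain ⟨u, hu, hTu⟩ := mem_separatingSpace_iff.1 hs
  have hpos : 0 < ‖q * s‖ := norm_pos_iff.2 hqs
  obtain ⟨N, hN⟩ := exists_nat_gt (C / (‖q * s‖ / 2))
  have h1 : Tendsto (fun n ↦ ‖(N : ℂ) • u n‖) atTop (𝓝 0) := by
    simpa using (hu.const_smul (N : ℂ)).norm
  have h2 : Tendsto (fun n ↦ ‖q * T (u n)‖) atTop (𝓝 ‖q * s‖) := (hTu.const_mul q).norm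
  obtain ⟨n, hn1, hn2⟩ := ((h1.eventually_le_const hε).and
    (h2.eventually_const_lt (half_lt_self hpos))).exists
  refine ⟨(N : ℂ) • u n, hn1, ?_⟩
  rw [map_smul, mul_smul_comm, norm_smul, Complex.norm_natCast]
  rw [div_lt_iff₀ (by positivity)] at hN
  exact hN.trans_le (by gcongr)

/-- In an orthogonal sequence of projections some member annihilates the separating space. -/
lemma exists_forall_mul_eq_zero (hT : IsIdempotentDerivationLike T) {q : ℕ → A}
    (hq : ∀ k, IsStarProjection (q k)) (horth : Pairwise fun i j ↦ q i * q j = 0) :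
    ∃ k, ∀ s ∈ separatingSpace T, q k * s = 0 := by
  by_contra! hbad
  choose s hs hqs using hbad
  choose d hd using fun k ↦ hT.left (q k) (hq k).isIdempotentElem
  choose x hx hlarge using fun k : ℕ ↦ exists_norm_le_lt_norm (hs k) (hqs k)
    (ε := (1 / 2) ^ k) (by positivity) (‖d k‖ * 3 + k)
  have hbound : ∀ k, ‖q k * x k‖ ≤ (1 / 2 : ℝ) ^ k := fun k ↦
    (norm_mul_le _ _).trans <| by
      simpa using mul_le_mul (IsStarProjection.norm_le _ (hq k)) (hx k) (norm_nonneg _) zero_le_one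
  have hsum : Summable fun k ↦ q k * x k := .of_norm_bounded summable_geometric_two hbound
  set y := ∑' k, q k * x k with hy
  have hy2 : ‖y‖ ≤ 2 := tsum_of_norm_bounded hasSum_geometric_two hbound
  have hqy : ∀ k, q k * y = q k * x k := by
    intro k
    rw [hy, ← hsum.tsum_mul_left, tsum_eq_single k]
    · rw [← mul_assoc, (hq k).isIdempotentElem.eq]
    · intro j hj
      rw [← mul_assoc, horth hj.symm, zero_mul]
  obtain ⟨k, hk⟩ := exists_nat_gt ‖T y‖
  have h1 : q k * T (x k) = d k * y + q k * T y - d k * x k := by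
    rw [← hd, hqy, hd, add_sub_cancel_left]
  have h2 : ‖q k * T (x k)‖ ≤ ‖d k‖ * 2 + 1 * ‖T y‖ + ‖d k‖ * 1 := by
    rw [h1]
    refine (norm_sub_le _ _).trans (add_le_add ((norm_add_le _ _).trans (add_le_add ?_ ?_)) ?_)
    · exact (norm_mul_le _ _).trans (by gcongr)
    · exact (norm_mul_le _ _).trans (by gcongr; exact IsStarProjection.norm_le _ (hq k))
    · exact (norm_mul_le _ _).trans (by
        gcongr; exact (hx k).trans (pow_le_one₀ (by norm_num) (by norm_num)))
  linarith [hlarge k]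

/-- If the separating space is nonzero, there is a projection that does not annihilate it but
cannot be split into two such projections. -/
lemma exists_indecomposable (hT : IsIdempotentDerivationLike T) (h : separatingSpace T ≠ ⊥) :
    ∃ q : A, IsStarProjection q ∧ (∃ s ∈ separatingSpace T, q * s ≠ 0) ∧
      ∀ r : A, IsStarProjection r → q * r = r → (∀ s ∈ separatingSpace T, r * s = 0) ∨
        ∀ s ∈ separatingSpace T, (q - r) * s = 0 := by
  by_contra! hsplit
  let B := {q : A // IsStarProjection q ∧ ∃ s ∈ separatingSpace T, q * s ≠ 0}
  have hstep : ∀ q : B, ∃ r : B, q.1 * r.1 = r.1 ∧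
      ∃ s ∈ separatingSpace T, (q.1 - r.1) * s ≠ 0 := fun q ↦ by
    obtain ⟨r, hr, hqr, hrs, hqrs⟩ := hsplit q.1 q.2.1 q.2.2
    exact ⟨⟨r, hr, hrs⟩, hqr, hqrs⟩
  choose next hnext hbad using hstep
  obtain ⟨s, hs, hs0⟩ := Submodule.exists_mem_ne_zero_of_ne_bot h
  let Q : ℕ → B := fun n ↦ next^[n] ⟨1, .one A, s, hs, by simpa using hs0⟩
  have hQ : ∀ n, Q (n + 1) = next (Q n) := fun n ↦ Function.iterate_succ_apply' next n _
  have hsucc : ∀ n, (Q n).1 * (Q (n + 1)).1 = (Q (n + 1)).1 := fun n ↦ by rw [hQ, hnext]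
  have hidem : ∀ n, (Q n).1 * (Q n).1 = (Q n).1 := fun n ↦ (Q n).2.1.isIdempotentElem.eq
  have hstar : ∀ n, star (Q n).1 = (Q n).1 := fun n ↦ (Q n).2.1.isSelfAdjoint.star_eq
  have hle : ∀ m n, m ≤ n → (Q m).1 * (Q n).1 = (Q n).1 := by
    intro m n hmn
    induction n, hmn using Nat.le_induction with
    | base => exact hidem m
    | succ n _ ih => rw [← hsucc n, ← mul_assoc, ih]
  have hlt : ∀ i j, i < j → ((Q i).1 - (Q (i + 1)).1) * ((Q j).1 - (Q (j + 1)).1) = 0 := by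
    intro i j hij
    simp only [sub_mul, mul_sub, hle i j hij.le, hle i (j + 1) (by lia), hle (i + 1) j hij,
      hle (i + 1) (j + 1) (by lia), sub_self]
  obtain ⟨k, hk⟩ := hT.exists_forall_mul_eq_zero (q := fun n ↦ (Q n).1 - (Q (n + 1)).1)
    (fun n ↦ (Q (n + 1)).2.1.sub_of_mul_eq_right (Q n).2.1 (hsucc n)) (fun i j hij ↦ by
      rcases hij.lt_or_gt with hij | hij
      · exact hlt i j hij
      · simpa [hstar] using congr(star $(hlt j i hij)))
  obtain ⟨s, hs, hks⟩ := hbad (Q k)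
  exact hks (by rw [← hQ]; exact hk s hs)

/-- Automatic continuity on Rickart C⋆-algebras. -/
theorem continuous (hT : IsIdempotentDerivationLike T) (hA : IsRickartCStar A) :
    Continuous T := by
  refine continuous_of_separatingSpace_eq_bot (by_contra fun hne ↦ ?_)
  obtain ⟨q, hq, ⟨s, hs, hqs⟩, hind⟩ := hT.exists_indecomposable hne
  have hqq : q * q = q := hq.isIdempotentElem.eq
  have hqstar : star q = q := hq.isSelfAdjoint.star_eq
  set t : A := q * s * star (q * s) with ht
  have htmem : t ∈ separatingSpace T := hT.mul_mem_right hA _ (hT.mul_mem_left hA _ hs)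
  have ht0 : t ≠ 0 := by rwa [ht, Ne, CStarRing.mul_star_self_eq_zero_iff]
  have hqt : q * t = t := by rw [ht, ← mul_assoc, ← mul_assoc, hqq]
  have htstar : star t = t := by simp [ht]
  let K : Submodule ℂ A := (ℂ ∙ t).comap (LinearMap.mulRight ℂ t)
  have hK : IsClosed (K : Set A) :=
    (Submodule.closed_of_finiteDimensional (ℂ ∙ t)).preimage (continuous_mul_const t)
  have hqK : q ∈ K := by
    change q * t ∈ ℂ ∙ t
    exact hqt.symm ▸ Submodule.mem_span_singleton_self t
  have hannK : ∀ r : A, (∀ s ∈ separatingSpace T, r * s = 0) → r ∈ K := fun r hr ↦ by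
    change r * t ∈ ℂ ∙ t
    rw [hr t htmem]
    exact zero_mem _
  have hsa : ∀ x : A, IsSelfAdjoint x → q * (x * q) ∈ K := by
    intro x hx
    let G : AddSubgroup A := selfAdjoint A ⊓ (AddMonoidHom.mulLeft q).eqLocus (AddMonoidHom.id A)
    have := mem_closure_of_norm_sub_le_half G K.toAddSubgroup (fun y hy ↦ ?_) (x := q * (x * q))
      ⟨?_, ?_⟩
    · rwa [Submodule.coe_toAddSubgroup, hK.closure_eq] at this
    · obtain ⟨hysa, hqy⟩ := hy
      change q * y = y at hqy
      obtain ⟨p, hp, hn, hpann⟩ := hA.exists_isStarProjection_norm_sub_le (x := y) hysa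
      have hqp : q * p = p := by
        have := hpann (1 - q) (by rw [sub_mul, one_mul, hqy, sub_self])
        rw [sub_mul, one_mul, sub_eq_zero] at this
        exact this.symm
      refine ⟨(‖y‖ / 2) • (p + p - q), K.smul_of_tower_mem _ ?_, ⟨?_, ?_⟩, ?_⟩
      · have hpK : p ∈ K := by
          rcases hind p hp hqp with h | h
          · exact hannK p h
          · simpa using K.sub_mem hqK (hannK _ h)
        exact K.sub_mem (K.add_mem hpK hpK) hqK
      · exact (IsSelfAdjoint.all (‖y‖ / 2)).smul
          ((hp.isSelfAdjoint.add hp.isSelfAdjoint).sub hq.isSelfAdjoint)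
      · change q * ((‖y‖ / 2) • (p + p - q)) = (‖y‖ / 2) • (p + p - q)
        rw [mul_smul_comm, mul_sub, mul_add, hqp, hqq]
      · have hfac : y - (‖y‖ / 2) • (p + p - q) = q * (y - (‖y‖ / 2) • (p + p - 1)) := by
          rw [mul_sub, mul_smul_comm, mul_sub, mul_add, hqp, hqy, mul_one]
        rw [hfac]
        refine (norm_mul_le _ _).trans ?_
        calc _ ≤ 1 * (‖y‖ / 2) := by
              gcongr
              exact IsStarProjection.norm_le _ hq
          _ = _ := one_mul _
    · change star (q * (x * q)) = q * (x * q)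
      simp [hqstar, hx.star_eq, mul_assoc]
    · change q * (q * (x * q)) = q * (x * q)
      rw [← mul_assoc, hqq]
  have hall : ∀ x : A, q * (x * q) ∈ K := fun x ↦
    mem_of_forall_isSelfAdjoint_mem
      (S := K.comap (LinearMap.mulLeft ℂ q ∘ₗ LinearMap.mulRight ℂ q)) hsa x
  have hscalar : ∀ x : A, ∃ c : ℂ, q * x * t = c • t := by
    intro x
    obtain ⟨c, hc⟩ := Submodule.mem_span_singleton.1 (show q * (x * q) * t ∈ ℂ ∙ t from hall x)
    exact ⟨c, by rw [hc, mul_assoc, mul_assoc, mul_assoc, hqt]⟩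
  obtain ⟨c, hc⟩ := hscalar t
  rw [hqt] at hc
  have hc0 : c ≠ 0 := by
    rintro rfl
    rw [zero_smul] at hc
    refine ht0 ((CStarRing.star_mul_self_eq_zero_iff t).1 ?_)
    rw [htstar, hc]
  have he : IsIdempotentElem (c⁻¹ • t) := by
    rw [IsIdempotentElem, smul_mul_smul_comm, hc, smul_smul, mul_assoc, inv_mul_cancel₀ hc0, mul_one]
  have := hT.eq_zero_of_corner he ((separatingSpace T).smul_mem _ htmem) fun x ↦ by
    obtain ⟨b, hb⟩ := hscalar (t * x)
    rw [← mul_assoc q t x, hqt] at hb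
    refine ⟨c⁻¹ * b, ?_⟩
    rw [smul_mul_assoc, smul_mul_smul_comm, hb, smul_smul, smul_smul]
    congr 1
    ring
  exact (smul_ne_zero (inv_ne_zero hc0) ht0) this

end IsIdempotentDerivationLike

section DerivationAtZero

variable {δ : A →ₗ[ℂ] A}

/-- The bilinear map `(a, b) ↦ δ a * b + a * δ b` is balanced over idempotents. -/
lemma derivationAtZero_balanced (hδ : ∀ a b : A, a * b = 0 → δ a * b + a * δ b = 0) {e : A}
    (he : IsIdempotentElem e) (a b : A) :
    δ (a * e) * b + a * e * δ b = δ a * (e * b) + a * δ (e * b) := by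
  have h1 := hδ (a * e) (b - e * b) (by
    rw [mul_sub, mul_assoc a e (e * b), ← mul_assoc e e b, he.eq, mul_assoc, sub_self])
  have h2 := hδ (a - a * e) (e * b) (by
    rw [sub_mul, mul_assoc a e (e * b), ← mul_assoc e e b, he.eq, sub_self])
  rw [← sub_eq_zero, ← sub_eq_zero_of_eq (h1.trans h2.symm), map_sub, map_sub]
  noncomm_ring

lemma derivationAtZero_one_comm (hδ : ∀ a b : A, a * b = 0 → δ a * b + a * δ b = 0) {e : A}
    (he : IsIdempotentElem e) : e * δ 1 = δ 1 * e := by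
  have := derivationAtZero_balanced hδ he 1 1
  simp only [one_mul, mul_one] at this
  rwa [add_comm, add_left_inj] at this

lemma derivationAtZero_idempotent_mul (hδ : ∀ a b : A, a * b = 0 → δ a * b + a * δ b = 0) {e : A}
    (he : IsIdempotentElem e) (b : A) : δ (e * b) = δ e * b + e * δ b - e * δ 1 * b := by
  have := derivationAtZero_balanced hδ he 1 b
  simp only [one_mul] at this
  rw [this, derivationAtZero_one_comm hδ he, mul_assoc, add_sub_cancel_left]

lemma derivationAtZero_mul_idempotent (hδ : ∀ a b : A, a * b = 0 → δ a * b + a * δ b = 0) {e : A}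
    (he : IsIdempotentElem e) (a : A) : δ (a * e) = δ a * e + a * δ e - a * e * δ 1 := by
  have := derivationAtZero_balanced hδ he a 1
  simp only [mul_one] at this
  rw [← this, add_sub_cancel_right]

lemma isIdempotentDerivationLike_of_derivationAtZero
    (hδ : ∀ a b : A, a * b = 0 → δ a * b + a * δ b = 0) : IsIdempotentDerivationLike δ where
  left e he := ⟨δ e - e * δ 1, fun b ↦ by
    rw [derivationAtZero_idempotent_mul hδ he]; noncomm_ring⟩
  right e he := ⟨δ e - e * δ 1, fun a ↦ by
    rw [derivationAtZero_mul_idempotent hδ he]; noncomm_ring⟩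

/-- A linear map on a Rickart C⋆-algebra that is a derivation at zero is continuous and a
generalized derivation. -/
theorem IsRickartCStar.continuous_and_generalizedDerivation (hA : IsRickartCStar A)
    (hδ : ∀ a b : A, a * b = 0 → δ a * b + a * δ b = 0) :
    Continuous δ ∧ ∀ x y : A, δ (x * y) = δ x * y + x * δ y - x * δ 1 * y := by
  have hcont : Continuous δ := (isIdempotentDerivationLike_of_derivationAtZero hδ).continuous hA
  refine ⟨hcont, fun x y ↦ ?_⟩
  let S : Submodule ℂ A := LinearMap.eqLocus (δ ∘ₗ LinearMap.mulRight ℂ y)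
    (LinearMap.mulRight ℂ y ∘ₗ δ + LinearMap.mulRight ℂ (δ y)
      - LinearMap.mulRight ℂ y ∘ₗ LinearMap.mulRight ℂ (δ 1))
  refine hA.mem_of_isClosed S (isClosed_eq ?_ ?_)
    (fun p hp ↦ derivationAtZero_idempotent_mul hδ hp.isIdempotentElem y) x
  · exact hcont.comp (continuous_mul_const y)
  · exact ((hcont.mul continuous_const).add (continuous_id.mul continuous_const)).sub
      ((continuous_id.mul continuous_const).mul continuous_const)

end DerivationAtZero

end CStar

section VonNeumann

variable {H : Type*} [NormedAddCommGroup H] [InnerProductSpace ℂ H] [CompleteSpace H]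

lemma VonNeumannAlgebra.isClosed_toStarSubalgebra_s15 (M : VonNeumannAlgebra H) :
    IsClosed (M.toStarSubalgebra : Set (H →L[ℂ] H)) := by
  rw [M.coe_toStarSubalgebra, ← M.centralizer_centralizer]
  exact Set.isClosed_centralizer _

lemma VonNeumannAlgebra.isRickartCStar (M : VonNeumannAlgebra H)
    [IsClosed (M.toStarSubalgebra : Set (H →L[ℂ] H))] : IsRickartCStar M.toStarSubalgebra := by
  intro a
  set K : Submodule ℂ H := (a : H →L[ℂ] H).ker with hK
  have : CompleteSpace K := (ContinuousLinearMap.isClosed_ker (a : H →L[ℂ] H)).completeSpace_coe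
  have hproj : IsStarProjection K.starProjection := isStarProjection_starProjection
  have hmem : K.starProjection ∈ M := by
    rw [IsStarProjection.mem_iff hproj]
    intro y hy
    rw [Submodule.range_starProjection, Module.End.mem_invtSubmodule]
    intro v hv
    have hc : (a : H →L[ℂ] H) * y = y * a := mem_commutant_iff.1 hy _ a.2
    have hv' : (a : H →L[ℂ] H) v = 0 := hv
    have := congr($hc v)
    simpa [hK, hv'] using this
  refine ⟨⟨K.starProjection, hmem⟩,
    ⟨Subtype.ext hproj.isIdempotentElem, Subtype.ext hproj.isSelfAdjoint⟩, fun y ↦ ?_⟩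
  rw [Subtype.ext_iff, Subtype.ext_iff, ContinuousLinearMap.ext_iff, ContinuousLinearMap.ext_iff]
  refine forall_congr' fun v ↦ ?_
  exact (Submodule.starProjection_eq_self_iff (K := K) (v := (y : H →L[ℂ] H) v)).symm

end VonNeumann

/-- A linear map `δ` on a von Neumann algebra which is a derivation at zero is a continuous
generalized derivation; if additionally `δ(1) = 0`, then `δ` is a derivation. -/
theorem stmt15 {H : Type*} [NormedAddCommGroup H] [InnerProductSpace ℂ H] [CompleteSpace H]
    (M : VonNeumannAlgebra H)
    (δ : M.toStarSubalgebra →ₗ[ℂ] M.toStarSubalgebra)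
    (hδ : ∀ a b : M.toStarSubalgebra, a * b = 0 → δ a * b + a * δ b = 0) :
    Continuous δ ∧
    (∀ x y : M.toStarSubalgebra, δ (x * y) = δ x * y + x * δ y - x * δ 1 * y) ∧
    (δ 1 = 0 → ∀ x y : M.toStarSubalgebra, δ (x * y) = δ x * y + x * δ y) := by
  have := M.isClosed_toStarSubalgebra_s15
  obtain ⟨hcont, hgen⟩ := M.isRickartCStar.continuous_and_generalizedDerivation hδ
  refine ⟨hcont, hgen, fun h1 x y ↦ ?_⟩
  rw [hgen, h1, mul_zero, zero_mul, sub_zero]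
end

section
/- Let A be a unital C*-algebra, let B be a C*-algebra, and let T : A → B be a continuous linear map which is a triple homomorphism at the unit 1 of A. Then e := T(1) is a partial isometry and the range of T is contained in the Peirce-2 subspace of e, that is, T(x) = e e* T(x) e* e for every x ∈ A. -/
open NormedSpace Filter Topology

/-- The exponentials of real multiples of a self-adjoint element whose coefficients sum to zero
have triple product `1`. -/
lemma trip_exp_smul_eq_one {A : Type*} [CStarAlgebra A] {h : A} (hh : IsSelfAdjoint h)
    {r s t : ℝ} (hrst : r + s + t = 0) :
    trip (exp (r • h)) (exp (s • h)) (exp (t • h)) = 1 := by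
  let _ : NormedAlgebra ℚ A := NormedAlgebra.restrictScalars ℚ ℂ A
  have hmul (u v : ℝ) : exp (u • h) * exp (v • h) = exp ((u + v) • h) := by
    rw [add_smul, exp_add_of_commute (((Commute.refl h).smul_left u).smul_right v)]
  have hstar : star (exp (s • h)) = exp (s • h) := by
    rw [star_exp, star_smul, hh.star_eq, star_trivial]
  have htsr : t + s + r = 0 := by linarith
  rw [trip, hstar, hmul, hmul, hmul, hmul, hrst, htsr, zero_smul, exp_zero, ← two_smul ℂ (1 : A),
    smul_smul]
  norm_num

/-- The derivative at `0` of a linear map along the exponential curve `u ↦ exp (u c h)`. -/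
lemma hasDerivAt_map_exp_smul {A B : Type*} [CStarAlgebra A] [CStarAlgebra B] {T : A →ₗ[ℂ] B}
    (hcont : Continuous T) (h : A) (c : ℝ) :
    HasDerivAt (fun u : ℝ => T (exp ((c * u) • h))) (c • T h) 0 := by
  let T' : A →L[ℝ] B := (⟨T, hcont⟩ : A →L[ℂ] B).restrictScalars ℝ
  have hexp : HasDerivAt (fun u : ℝ => exp ((c * u) • h)) (c • h) 0 := by
    simpa [smul_smul, mul_comm] using hasDerivAt_exp_smul_const (𝕂 := ℝ) (c • h) 0
  simpa [T', Function.comp_def] using T'.hasFDerivAt.comp_hasDerivAt (0 : ℝ) hexp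

/-- In a C*-algebra, `y y* y = 0` forces `y = 0`. -/
lemma eq_zero_of_mul_star_mul_self_eq_zero {B : Type*} [CStarAlgebra B] {y : B}
    (hy : y * star y * y = 0) : y = 0 := by
  rw [← CStarRing.star_mul_self_eq_zero_iff, ← CStarRing.star_mul_self_eq_zero_iff]
  rw [star_mul, star_star, mul_assoc, ← mul_assoc y, hy, mul_zero]

section TripleHomAtOne

variable {A B : Type*} [CStarAlgebra A] [CStarAlgebra B] {T : A →ₗ[ℂ] B}

lemma map_one_mul_star_mul_self_of_trip
    (hT : ∀ a b c : A, trip a b c = 1 → trip (T a) (T b) (T c) = T 1) :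
    T 1 * star (T 1) * T 1 = T 1 := by
  have hone : trip (1 : A) 1 1 = 1 := by
    simpa using trip_exp_smul_eq_one (IsSelfAdjoint.zero A) (show (0 : ℝ) + 0 + 0 = 0 by simp)
  have h := hT 1 1 1 hone
  rw [trip, ← two_smul ℂ, smul_smul] at h
  simpa using h

/-- The linearization of the triple identity at `1` along a self-adjoint direction. -/
lemma map_selfAdjoint_trip_identity (hcont : Continuous T)
    (hT : ∀ a b c : A, trip a b c = 1 → trip (T a) (T b) (T c) = T 1)
    {h : A} (hh : IsSelfAdjoint h) :
    T h * star (T 1) * T 1 + T 1 * star (T 1) * T h =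
      T 1 * star (T h) * T 1 + T 1 * star (T h) * T 1 := by
  have hF := hasDerivAt_map_exp_smul hcont h 1
  have hG := (hasDerivAt_map_exp_smul hcont h (-1)).star
  have hd := ((hF.fun_mul hG).mul_const (T 1)).fun_add ((hG.const_mul (T 1)).fun_mul hF)
  have hconst : (fun u : ℝ => T (exp ((1 * u) • h)) * star (T (exp ((-1 * u) • h))) * T 1
      + T 1 * star (T (exp ((-1 * u) • h))) * T (exp ((1 * u) • h))) =
      fun _ => (2 : ℂ) • T 1 := by
    funext u
    have := hT _ _ _ (trip_exp_smul_eq_one hh (r := 1 * u) (s := -1 * u) (t := 0) (by ring))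
    rw [zero_smul, exp_zero, trip] at this
    exact (inv_smul_eq_iff₀ two_ne_zero).1 this
  rw [hconst] at hd
  have h0 := hd.unique (hasDerivAt_const _ _)
  simp only [mul_zero, zero_smul, exp_zero, one_smul, neg_smul, star_neg, mul_neg, neg_mul,
    add_mul] at h0
  rw [← sub_eq_zero, ← h0]
  abel

/-- The mixed Peirce components of the range vanish: left multiplication by `e e*` and right
multiplication by `e* e` agree on it. -/
lemma map_one_mul_star_mul_map_comm (hcont : Continuous T)
    (hT : ∀ a b c : A, trip a b c = 1 → trip (T a) (T b) (T c) = T 1) (a : A) :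
    T 1 * star (T 1) * T a = T a * (star (T 1) * T 1) := by
  have he := map_one_mul_star_mul_self_of_trip hT
  have hsa {h : A} (hh : IsSelfAdjoint h) :
      T 1 * star (T 1) * T h = T h * (star (T 1) * T 1) := by
    have hid := map_selfAdjoint_trip_identity hcont hT hh
    generalize T 1 = e at *
    generalize T h = x at *
    have hl := congrArg (fun z => e * star e * z) hid
    have hr := congrArg (fun z => z * (star e * e)) hid
    have he' (z : B) : e * (star e * (e * z)) = e * z := by
      simp only [← mul_assoc, he]
    simp only [mul_assoc, mul_add, add_mul] at hl hr he hid ⊢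
    simp only [he', he] at hl hr
    rw [← hid] at hl hr
    have h1 := add_right_cancel hl
    have h2 := add_left_cancel hr
    rw [← h2, h1]
  rw [← realPart_add_I_smul_imaginaryPart a]
  simp only [map_add, map_smul, mul_add, add_mul, mul_smul_comm, smul_mul_assoc,
    hsa (realPart a).2, hsa (imaginaryPart a).2]

/-- The Peirce-0 component of the image of a self-adjoint element vanishes. -/
lemma map_one_mul_star_mul_map_selfAdjoint (hcont : Continuous T)
    (hT : ∀ a b c : A, trip a b c = 1 → trip (T a) (T b) (T c) = T 1)
    {h : A} (hh : IsSelfAdjoint h) :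
    T 1 * star (T 1) * T h = T h := by
  have he := map_one_mul_star_mul_self_of_trip hT
  have hcomm := map_one_mul_star_mul_map_comm hcont hT
  set D : B := 1 - T 1 * star (T 1) with hD
  have hDe : D * T 1 = 0 := by rw [hD, sub_mul, one_mul, he, sub_self]
  have hDstar : star D = D := by simp [hD]
  have hprod {a b : A} (hab : trip a b a = 1) :
      D * T a * star (D * T b) * (D * T a) = 0 := by
    have habT := hT a b a hab
    rw [trip, ← two_smul ℂ, smul_smul, inv_mul_cancel₀ two_ne_zero, one_smul] at habT
    have hDD : D * D = D := by
      nth_rewrite 2 [hD]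
      rw [mul_sub, mul_one, ← mul_assoc, hDe, zero_mul, sub_zero]
    have hbD : star (T b) * D = (1 - star (T 1) * T 1) * star (T b) := by
      have := congrArg star (hcomm b)
      simp only [star_mul, star_star] at this
      rw [hD, mul_sub, sub_mul, mul_one, one_mul, this]
    have haD : D * T a * (star (T 1) * T 1) = 0 := by
      rw [mul_assoc, ← hcomm a, ← mul_assoc, ← mul_assoc, hDe, zero_mul, zero_mul]
    calc D * T a * star (D * T b) * (D * T a)
        = D * T a * (star (T b) * (D * D)) * T a := by
          rw [star_mul, hDstar]; simp only [mul_assoc]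
      _ = (D * T a - D * T a * (star (T 1) * T 1)) * star (T b) * T a := by
          rw [hDD, hbD, ← mul_assoc, mul_sub, mul_one]
      _ = D * (T a * star (T b) * T a) := by
          rw [haD, sub_zero]; simp only [mul_assoc]
      _ = 0 := by rw [habT, hDe]
  have hslope (c : ℝ) : Tendsto (fun t : ℝ => t⁻¹ • (D * T (exp ((c * t) • h)))) (𝓝[≠] 0)
      (𝓝 (D * (c • T h))) := by
    simpa [hDe] using ((hasDerivAt_map_exp_smul hcont h c).const_mul D).tendsto_slope_zero
  have hlim := ((hslope 1).mul (hslope (-2)).star).mul (hslope 1)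
  have hzero : D * T h * star (D * T h) * (D * T h) = 0 := by
    have hev (t : ℝ) := hprod (trip_exp_smul_eq_one hh (r := 1 * t) (s := -2 * t) (t := 1 * t)
      (by ring))
    simp only [star_smul, smul_mul_assoc, mul_smul_comm, hev, smul_zero] at hlim
    have := tendsto_nhds_unique hlim tendsto_const_nhds
    simpa using this
  have := eq_zero_of_mul_star_mul_self_eq_zero hzero
  rw [hD, sub_mul, one_mul, sub_eq_zero] at this
  exact this.symm

lemma map_mem_peirceTwo_of_trip (hcont : Continuous T)
    (hT : ∀ a b c : A, trip a b c = 1 → trip (T a) (T b) (T c) = T 1) (x : A) :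
    T x = T 1 * star (T 1) * T x * star (T 1) * T 1 := by
  have hleft : T 1 * star (T 1) * T x = T x := by
    rw [← realPart_add_I_smul_imaginaryPart x]
    simp only [map_add, map_smul, mul_add, mul_smul_comm,
      map_one_mul_star_mul_map_selfAdjoint hcont hT (realPart x).2,
      map_one_mul_star_mul_map_selfAdjoint hcont hT (imaginaryPart x).2]
  rw [hleft, mul_assoc, ← map_one_mul_star_mul_map_comm hcont hT, hleft]

end TripleHomAtOne

/-- If `T : A → B` is a continuous linear map between C*-algebras (`A` unital) which is a
triple homomorphism at the unit of `A`, then `e := T(1)` is a partial isometry and the range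
of `T` lies in the Peirce-2 subspace of `e`: `T(x) = e e* T(x) e* e` for all `x`. -/
theorem stmt18 {A B : Type*} [CStarAlgebra A] [NonUnitalCStarAlgebra B] (T : A →ₗ[ℂ] B)
    (hcont : Continuous T)
    (hT : ∀ a b c : A, trip a b c = 1 → trip (T a) (T b) (T c) = T 1) :
    T 1 * star (T 1) * T 1 = T 1 ∧
    (∀ x : A, T x = T 1 * star (T 1) * T x * star (T 1) * T 1) := by
  let S : A →ₗ[ℂ] Unitization ℂ B := (Unitization.inrHom ℂ ℂ B).comp T
  have hS (a : A) : S a = (T a : Unitization ℂ B) := rfl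
  have hScont : Continuous S := Unitization.continuous_inr.comp hcont
  have hST (a b c : A) (habc : trip a b c = 1) : trip (S a) (S b) (S c) = S 1 := by
    simp only [hS, ← hT a b c habc, trip, Unitization.inr_smul, Unitization.inr_add,
      Unitization.inr_mul, Unitization.inr_star]
  refine ⟨Unitization.inr_injective (R := ℂ) ?_, fun x => Unitization.inr_injective (R := ℂ) ?_⟩
  · simpa [hS] using map_one_mul_star_mul_self_of_trip hST
  · simpa [hS] using map_mem_peirceTwo_of_trip hScont hST x
end
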